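/- Let S ⊂ ℙ(V) be a reduced irreducible ruled surface of degree d ≥ 3, not a cone, with associated irreducible curve C ⊂ Gr(2,V). Suppose dim P(C) = 3 and P(C) is the intersection of exactly two tangent spaces of Gr, at points w̄₁ ≠ w̄₂. Then the lines w̄₁ and w̄₂ of ℙ(V) are disjoint; for a suitable choice of homogeneous coordinates t₁, t₂, t₃, t₄ of ℙ(V), the equation F of S is bi-homogeneous of some bi-degree (a₁, a₂) with a₁ + a₂ = d in the pairs of variables (t₁, t₂) and (t₃, t₄); the isolated lines of S are exactly w̄₁ and w̄₂ (i.e., C̃ \ C = {w̄₁, w̄₂}); the lines w̄₁, w̄₂ are directrices of S; and the singular locus of S consists of those lines w̄ᵢ with aᵢ > 1 together with the lines w̄ ⊂ S corresponding to singular points w̄ of C. -/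

import Mathlib

namespace RQS

open MvPolynomial


open MvPolynomial

variable (K : Type) [Field K]

/-- Projective n-space modelled as the projectivization of `Fin n → K`
(so `PP K (n+1)` is ℙⁿ). -/
abbrev PP (n : ℕ) : Type := Projectivization K (Fin n → K)

variable {K}

/-- Vanishing of a (homogeneous) polynomial at a projective point. -/
def vanishes {n : ℕ} (p : MvPolynomial (Fin n) K) (x : PP K n) : Prop :=
  ∀ (v : Fin n → K) (h : v ≠ 0), Projectivization.mk K v h = x → eval v p = 0

/-- Projective zero locus of a set of polynomials. -/
def zeroLocus {n : ℕ} (S : Set (MvPolynomial (Fin n) K)) : Set (PP K n) :=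
  {x | ∀ p ∈ S, vanishes p x}

/-- Zariski closed subsets of projective space. -/
def ZClosed {n : ℕ} (X : Set (PP K n)) : Prop :=
  ∃ S : Set (MvPolynomial (Fin n) K), (∀ p ∈ S, ∃ d, p.IsHomogeneous d) ∧ X = zeroLocus S

/-- Irreducibility with respect to the Zariski topology. -/
def ZIrred {n : ℕ} (X : Set (PP K n)) : Prop :=
  X.Nonempty ∧ ∀ A B : Set (PP K n), ZClosed A → ZClosed B → X ⊆ A ∪ B → X ⊆ A ∨ X ⊆ B

/-- `X` contains a chain of closed irreducible subsets of length `d+1`. -/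
def dimGE {n : ℕ} (X : Set (PP K n)) (d : ℕ) : Prop :=
  ∃ f : Fin (d + 1) → Set (PP K n),
    (∀ i, ZClosed (f i) ∧ ZIrred (f i) ∧ f i ⊆ X) ∧ StrictMono f

/-- `X` has (Krull) dimension exactly `d`. -/
def HasDim {n : ℕ} (X : Set (PP K n)) (d : ℕ) : Prop := dimGE X d ∧ ¬ dimGE X (d + 1)

/-- The hyperplane with coefficient vector `φ`. -/
def hyp {n : ℕ} (φ : Fin n → K) : Set (PP K n) :=
  {x | ∀ (v : Fin n → K) (h : v ≠ 0), Projectivization.mk K v h = x → ∑ i, φ i * v i = 0}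

/-- Degree of a (reduced) curve: every hyperplane not containing it meets it in at most `d`
points, and some hyperplane meets it in exactly `d` points. -/
def HasCurveDeg {n : ℕ} (X : Set (PP K n)) (d : ℕ) : Prop :=
  (∀ φ : Fin n → K, φ ≠ 0 → ¬ X ⊆ hyp φ →
    (X ∩ hyp φ).Finite ∧ (X ∩ hyp φ).ncard ≤ d) ∧
  (∃ φ : Fin n → K, φ ≠ 0 ∧ ¬ X ⊆ hyp φ ∧ (X ∩ hyp φ).ncard = d)

/-- An irreducible projective curve of degree `d`. -/
def IsCurveOfDeg {n : ℕ} (X : Set (PP K n)) (d : ℕ) : Prop :=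
  ZClosed X ∧ ZIrred X ∧ HasDim X 1 ∧ HasCurveDeg X d

/-- A property holds at a general point of `S`. -/
def GenericPts {n : ℕ} (S : Set (PP K n)) (Q : PP K n → Prop) : Prop :=
  ∃ T : Set (PP K n), ZClosed T ∧ ¬ S ⊆ T ∧ ∀ p ∈ S, p ∉ T → Q p

/-! ### Plücker coordinates: `p₁₂,p₁₃,p₁₄,p₂₃,p₂₄,p₃₄` indexed by `0,…,5` -/

/-- Plücker coordinates of the line through `u` and `v`, i.e. the bivector `u ∧ v`. -/
def plucker (u v : Fin 4 → K) : Fin 6 → K :=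
  ![u 0 * v 1 - u 1 * v 0, u 0 * v 2 - u 2 * v 0, u 0 * v 3 - u 3 * v 0,
    u 1 * v 2 - u 2 * v 1, u 1 * v 3 - u 3 * v 1, u 2 * v 3 - u 3 * v 2]

/-- The Plücker quadric `p₁₂p₃₄ - p₁₃p₂₄ + p₁₄p₂₃`, i.e. `½ w ∧ w`. -/
def plQuad (w : Fin 6 → K) : K := w 0 * w 5 - w 1 * w 4 + w 2 * w 3

/-- The wedge pairing `w ∧ z ∈ Λ⁴V ≅ K` of two bivectors. -/
def plPair (w z : Fin 6 → K) : K :=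
  w 0 * z 5 + w 5 * z 0 - w 1 * z 4 - w 4 * z 1 + w 2 * z 3 + w 3 * z 2

/-- The wedge `w ∧ v ∈ Λ³V ≅ V*` of a bivector `w` with a vector `v`;
`w ∧ v = 0` expresses that the point `v̄` lies on the line `w̄`. -/
def wedgePt (w : Fin 6 → K) (v : Fin 4 → K) : Fin 4 → K :=
  ![w 0 * v 2 - w 1 * v 1 + w 3 * v 0,
    w 0 * v 3 - w 2 * v 1 + w 4 * v 0,
    w 1 * v 3 - w 2 * v 2 + w 5 * v 0,
    w 3 * v 3 - w 4 * v 2 + w 5 * v 1]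

/-- The set of points of ℙ³ on the line with Plücker vector `w`. -/
def lineOfRep (w : Fin 6 → K) : Set (PP K 4) :=
  {p | ∀ (v : Fin 4 → K) (h : v ≠ 0), Projectivization.mk K v h = p → wedgePt w v = 0}

/-- `w` represents a line of ℙ³: it is nonzero and decomposable. -/
def IsLineRep (w : Fin 6 → K) : Prop := w ≠ 0 ∧ plQuad w = 0

variable (K) in
/-- The Grassmannian `Gr(2,4) ⊂ ℙ⁵` of lines in ℙ³. -/
def grass : Set (PP K 6) :=
  {x | ∃ (w : Fin 6 → K) (h : w ≠ 0), Projectivization.mk K w h = x ∧ plQuad w = 0}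

/-- The line in ℙ³ corresponding to a point `x` of the Grassmannian. -/
def lineOf (x : PP K 6) : Set (PP K 4) :=
  {p | ∀ (w : Fin 6 → K) (h : w ≠ 0), Projectivization.mk K w h = x → p ∈ lineOfRep w}

/-- The set of (Grassmann points of) lines contained in a surface `S ⊂ ℙ³`. -/
def linesOf (S : Set (PP K 4)) : Set (PP K 6) :=
  {x | x ∈ grass K ∧ lineOf x ⊆ S}

/-- A ruled surface: an irreducible closed surface which is a union of lines. -/
def IsRuled (S : Set (PP K 4)) : Prop :=
  ZClosed S ∧ ZIrred S ∧ HasDim S 2 ∧ ∀ p ∈ S, ∃ x ∈ linesOf S, p ∈ lineOf x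

/-- Degree of a surface in ℙ³ via intersections with lines. -/
def HasSurfDeg (S : Set (PP K 4)) (d : ℕ) : Prop :=
  (∀ w : Fin 6 → K, IsLineRep w → ¬ lineOfRep w ⊆ S →
    (S ∩ lineOfRep w).Finite ∧ (S ∩ lineOfRep w).ncard ≤ d) ∧
  (∃ w : Fin 6 → K, IsLineRep w ∧ ¬ lineOfRep w ⊆ S ∧ (S ∩ lineOfRep w).ncard = d)

/-- A cone: all lines of `S` pass through a common point. -/
def IsCone (S : Set (PP K 4)) : Prop :=
  ∃ p : PP K 4, ∀ x ∈ linesOf S, p ∈ lineOf x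

/-- `σ₂(p₀)`: the 2-plane in the Grassmannian of all lines through `p₀`. -/
def sigma2 (p₀ : PP K 4) : Set (PP K 6) := {x | x ∈ grass K ∧ p₀ ∈ lineOf x}

/-- The projective tangent space `T_{Gr,x₀}` of the Plücker quadric at `x₀`,
namely the hyperplane `{z̄ : w₀ ∧ z = 0}`. -/
def tangentGr (x₀ : PP K 6) : Set (PP K 6) :=
  {x | ∀ (w : Fin 6 → K) (h : w ≠ 0), Projectivization.mk K w h = x →
    ∀ (w₀ : Fin 6 → K) (h₀ : w₀ ≠ 0), Projectivization.mk K w₀ h₀ = x₀ → plPair w₀ w = 0}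

/-- The linear span of (the representatives of) a subset of projective space. -/
def spanOfSet {n : ℕ} (X : Set (PP K n)) : Submodule K (Fin n → K) :=
  Submodule.span K {v | ∃ h : v ≠ 0, Projectivization.mk K v h ∈ X}

/-- The projective subspace associated to a linear subspace. -/
def projSub {n : ℕ} (U : Submodule K (Fin n → K)) : Set (PP K n) :=
  {x | ∀ (v : Fin n → K) (h : v ≠ 0), Projectivization.mk K v h = x → v ∈ U}

/-- `P(C)`: the smallest projective subspace containing `C`. -/
def projSpanOf {n : ℕ} (X : Set (PP K n)) : Set (PP K n) := projSub (spanOfSet X)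

/-! ### Smoothness via Jacobian criteria -/

/-- The homogeneous polynomials vanishing on `X`. -/
def homIdeal {n : ℕ} (X : Set (PP K n)) : Set (MvPolynomial (Fin n) K) :=
  {p | (∃ d, p.IsHomogeneous d) ∧ ∀ x ∈ X, vanishes p x}

/-- The span of the gradients at `v` of all homogeneous polynomials vanishing on `X`. -/
def gradSpan {n : ℕ} (X : Set (PP K n)) (v : Fin n → K) : Submodule K (Fin n → K) :=
  Submodule.span K
    {g | ∃ p ∈ homIdeal X, g = fun i => eval v (pderiv i p)}

/-- Smooth point of a projective *curve* `X ⊂ ℙ(Kⁿ)` (Jacobian criterion: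
the affine cone over `X` has a 2-dimensional tangent space there). -/
def CurveSmoothPt {n : ℕ} (X : Set (PP K n)) (x : PP K n) : Prop :=
  ∀ (v : Fin n → K) (h : v ≠ 0), Projectivization.mk K v h = x →
    Module.finrank K (gradSpan X v) = n - 2

/-- Smooth point of a *surface* `S ⊂ ℙ³` (Jacobian criterion). -/
def SurfSmoothPt (S : Set (PP K 4)) (x : PP K 4) : Prop :=
  ∀ (v : Fin 4 → K) (h : v ≠ 0), Projectivization.mk K v h = x →
    Module.finrank K (gradSpan S v) = 1

/-- The singular locus of a surface `S ⊂ ℙ³`. -/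
def singLocus (S : Set (PP K 4)) : Set (PP K 4) := {x ∈ S | ¬ SurfSmoothPt S x}


/-- The automorphism of projective space induced by a linear automorphism
(a projective coordinate change). -/
def projMap {n : ℕ} (A : (Fin n → K) ≃ₗ[K] (Fin n → K)) : PP K n → PP K n :=
  Projectivization.map A.toLinearMap A.injective

/-- Two subsets of projective space are projectively equivalent. -/
def ProjEquiv {n : ℕ} (S T : Set (PP K n)) : Prop :=
  ∃ A : (Fin n → K) ≃ₗ[K] (Fin n → K), projMap A '' S = T

/-! ### Membership in terms of representatives -/

lemma mk_smul {n : ℕ} {c : K} {v : Fin n → K} (h : v ≠ 0) (hcv : c • v ≠ 0) :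
    Projectivization.mk K (c • v) hcv = Projectivization.mk K v h :=
  (Projectivization.mk_eq_mk_iff' K _ _ _ _).2 ⟨c, rfl⟩

/-- A scaling-invariant property of representatives can be tested on one representative. -/
lemma forall_mk_eq_iff {n : ℕ} {P : (Fin n → K) → Prop}
    (hP : ∀ (c : K) v, P v → P (c • v)) {v : Fin n → K} (hv : v ≠ 0) :
    (∀ (u : Fin n → K) (h : u ≠ 0), Projectivization.mk K u h = Projectivization.mk K v hv → P u)
      ↔ P v := by
  refine ⟨fun H => H v hv rfl, fun H u hu e => ?_⟩
  obtain ⟨c, rfl⟩ := (Projectivization.mk_eq_mk_iff' K _ _ _ _).1 e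
  exact hP c v H

lemma plPair_smul_right (c : K) (w z : Fin 6 → K) : plPair w (c • z) = c * plPair w z := by
  simp only [plPair, Pi.smul_apply, smul_eq_mul]; ring

lemma plPair_smul_left (c : K) (w z : Fin 6 → K) : plPair (c • w) z = c * plPair w z := by
  simp only [plPair, Pi.smul_apply, smul_eq_mul]; ring

lemma plQuad_smul (c : K) (w : Fin 6 → K) : plQuad (c • w) = c ^ 2 * plQuad w := by
  simp only [plQuad, Pi.smul_apply, smul_eq_mul]; ring

lemma plQuad_add (w z : Fin 6 → K) : plQuad (w + z) = plQuad w + plQuad z + plPair w z := by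
  simp only [plQuad, plPair, Pi.add_apply]; ring

lemma wedgePt_smul_left (c : K) (w : Fin 6 → K) (v : Fin 4 → K) :
    wedgePt (c • w) v = c • wedgePt w v := by
  ext i; fin_cases i <;> simp [wedgePt] <;> ring

lemma wedgePt_smul_right (c : K) (w : Fin 6 → K) (v : Fin 4 → K) :
    wedgePt w (c • v) = c • wedgePt w v := by
  ext i; fin_cases i <;> simp [wedgePt] <;> ring

lemma mk_mem_lineOfRep {w : Fin 6 → K} {v : Fin 4 → K} (hv : v ≠ 0) :
    Projectivization.mk K v hv ∈ lineOfRep w ↔ wedgePt w v = 0 :=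
  forall_mk_eq_iff (P := fun v => wedgePt w v = 0)
    (fun c v h => by rw [wedgePt_smul_right, h, smul_zero]) hv

lemma lineOf_mk {w : Fin 6 → K} (hw : w ≠ 0) :
    lineOf (Projectivization.mk K w hw) = lineOfRep w := by
  ext p
  induction p using Projectivization.ind with | h v hv => ?_
  refine forall_mk_eq_iff (P := fun w => Projectivization.mk K v hv ∈ lineOfRep w)
    (fun c w h => ?_) hw
  rw [mk_mem_lineOfRep] at h ⊢
  rw [wedgePt_smul_left, h, smul_zero]

lemma mk_mem_lineOf {w : Fin 6 → K} (hw : w ≠ 0) {v : Fin 4 → K} (hv : v ≠ 0) :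
    Projectivization.mk K v hv ∈ lineOf (Projectivization.mk K w hw) ↔ wedgePt w v = 0 := by
  rw [lineOf_mk, mk_mem_lineOfRep]

lemma mk_mem_grass {w : Fin 6 → K} (hw : w ≠ 0) :
    Projectivization.mk K w hw ∈ grass K ↔ plQuad w = 0 := by
  constructor
  · rintro ⟨z, hz, e, hq⟩
    obtain ⟨c, rfl⟩ := (Projectivization.mk_eq_mk_iff' K _ _ _ _).1 e.symm
    rw [plQuad_smul, hq, mul_zero]
  · exact fun h => ⟨w, hw, rfl, h⟩

lemma mk_mem_tangentGr {w z : Fin 6 → K} (hw : w ≠ 0) (hz : z ≠ 0) :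
    Projectivization.mk K z hz ∈ tangentGr (Projectivization.mk K w hw) ↔ plPair w z = 0 := by
  refine (forall_mk_eq_iff (P := fun z => ∀ (w₀ : Fin 6 → K) (h₀ : w₀ ≠ 0),
    Projectivization.mk K w₀ h₀ = Projectivization.mk K w hw → plPair w₀ z = 0)
    (fun c v H w₀ h₀ e => by rw [plPair_smul_right, H w₀ h₀ e, mul_zero]) hz).trans ?_
  exact forall_mk_eq_iff (P := fun w => plPair w z = 0)
    (fun c v h => by rw [plPair_smul_left, h, mul_zero]) hw

lemma mk_mem_projSub {n : ℕ} {U : Submodule K (Fin n → K)} {v : Fin n → K} (hv : v ≠ 0) :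
    Projectivization.mk K v hv ∈ projSub U ↔ v ∈ U :=
  forall_mk_eq_iff (P := fun v => v ∈ U) (fun c _ h => U.smul_mem c h) hv

lemma mk_mem_hyp {n : ℕ} {φ v : Fin n → K} (hv : v ≠ 0) :
    Projectivization.mk K v hv ∈ hyp φ ↔ ∑ i, φ i * v i = 0 :=
  forall_mk_eq_iff (P := fun v => ∑ i, φ i * v i = 0)
    (fun c v h => by
      have : ∑ i, φ i * (c • v) i = c * ∑ i, φ i * v i := by
        rw [Finset.mul_sum]
        exact Finset.sum_congr rfl fun i _ => by simp; ring
      rw [this, h, mul_zero]) hv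

/-- Rescaling the variables by powers of `c` prescribed by the weights. -/
lemma eval_weighted_smul {σ : Type*} {w : σ → ℕ} {p : MvPolynomial σ K} {m : ℕ}
    (hp : IsWeightedHomogeneous w p m) (c : K) (v : σ → K) :
    eval (fun i => c ^ w i * v i) p = c ^ m * eval v p := by
  rw [eval_eq, eval_eq, Finset.mul_sum]
  refine Finset.sum_congr rfl fun d hd => ?_
  have h := hp (mem_support_iff.1 hd)
  rw [← h, Finsupp.weight_apply, Finsupp.sum, ← Finset.prod_pow_eq_pow_sum]
  simp_rw [mul_pow, Finset.prod_mul_distrib, ← pow_mul, smul_eq_mul, mul_comm (w _)]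
  ring

lemma eval_smul_of_isHomogeneous {σ : Type*} {p : MvPolynomial σ K} {m : ℕ}
    (hp : p.IsHomogeneous m) (c : K) (v : σ → K) : eval (c • v) p = c ^ m * eval v p := by
  rw [← eval_weighted_smul hp c v]
  congr 2
  ext i; simp

lemma vanishes_mk {n : ℕ} {p : MvPolynomial (Fin n) K} {m : ℕ} (hp : p.IsHomogeneous m)
    {v : Fin n → K} (hv : v ≠ 0) :
    vanishes p (Projectivization.mk K v hv) ↔ eval v p = 0 :=
  forall_mk_eq_iff (P := fun v => eval v p = 0)
    (fun c v h => by rw [eval_smul_of_isHomogeneous hp, h, mul_zero]) hv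

lemma zClosed_hyp {n : ℕ} (φ : Fin n → K) : ZClosed (hyp φ) := by
  refine ⟨{∑ i, C (φ i) * X i}, ?_, ?_⟩
  · rintro p rfl
    exact ⟨1, IsHomogeneous.sum _ _ _ fun i _ => by
      simpa using (isHomogeneous_C (Fin n) (φ i)).mul (isHomogeneous_X K i)⟩
  · ext x
    simp [hyp, zeroLocus, vanishes]

/-! ### Lines and decomposable bivectors -/

lemma plQuad_plucker (u v : Fin 4 → K) : plQuad (plucker u v) = 0 := by
  simp [plQuad, plucker]; ring

lemma plucker_comb (a b c d : K) (u v : Fin 4 → K) :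
    plucker (a • u + b • v) (c • u + d • v) = (a * d - b * c) • plucker u v := by
  ext i; fin_cases i <;> simp [plucker] <;> ring

lemma wedgePt_plucker_comb (u v : Fin 4 → K) (a b : K) :
    wedgePt (plucker u v) (a • u + b • v) = 0 := by
  ext i; fin_cases i <;> simp [plucker, wedgePt] <;> ring

lemma ne_zero_of_plucker_ne_zero {u v : Fin 4 → K} (h : plucker u v ≠ 0) : u ≠ 0 ∧ v ≠ 0 := by
  constructor <;> rintro rfl <;> apply h <;> ext i <;> fin_cases i <;> simp [plucker]

lemma comb_eq_zero {u v : Fin 4 → K} (h : plucker u v ≠ 0) {a b : K}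
    (hab : a • u + b • v = 0) : a = 0 ∧ b = 0 := by
  constructor
  · have := plucker_comb a b 0 1 u v
    rw [hab] at this
    by_contra ha
    apply (ne_zero_of_plucker_ne_zero (u := 0) (v := (0 : K) • u + (1 : K) • v) ?_).1 rfl
    rw [this]; simpa [ha] using h
  · have := plucker_comb a b 1 0 u v
    rw [hab] at this
    by_contra ha
    apply (ne_zero_of_plucker_ne_zero (u := 0) (v := (1 : K) • u + (0 : K) • v) ?_).1 rfl
    rw [this]; simpa [ha] using h

lemma exists_comb_of_wedgePt {u v y : Fin 4 → K} (h : plucker u v ≠ 0)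
    (hy : wedgePt (plucker u v) y = 0) : ∃ a b : K, y = a • u + b • v := by
  have h0 := congrFun hy 0
  have h1 := congrFun hy 1
  have h2 := congrFun hy 2
  have h3 := congrFun hy 3
  simp only [wedgePt, plucker, Matrix.cons_val, Pi.zero_apply] at h0 h1 h2 h3
  have minors : ∀ i j k : Fin 4, y k * (u i * v j - u j * v i) =
      (y i * v j - y j * v i) * u k + (u i * y j - u j * y i) * v k := by
    intro i j k
    fin_cases i <;> fin_cases j <;> fin_cases k <;>
      simp only [Fin.zero_eta, Fin.mk_one, Fin.reduceFinMk] <;>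
      first
        | ring1
        | linear_combination h0 | linear_combination -h0
        | linear_combination h1 | linear_combination -h1
        | linear_combination h2 | linear_combination -h2
        | linear_combination h3 | linear_combination -h3
  have key : ∀ i j : Fin 4, u i * v j - u j * v i ≠ 0 →
      y = ((y i * v j - y j * v i) / (u i * v j - u j * v i)) • u +
        ((u i * y j - u j * y i) / (u i * v j - u j * v i)) • v := by
    intro i j hij
    ext k
    simp only [Pi.add_apply, Pi.smul_apply, smul_eq_mul]
    rw [div_mul_eq_mul_div, div_mul_eq_mul_div, ← add_div, eq_div_iff hij]
    exact minors i j k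
  by_contra hcon
  push Not at hcon
  have hz : ∀ i j : Fin 4, u i * v j - u j * v i = 0 := fun i j => by
    by_contra hij
    exact hcon _ _ (key i j hij)
  apply h
  ext i
  fin_cases i <;> simp [plucker, hz]

lemma wedgePt_plucker_eq_zero_iff {u v y : Fin 4 → K} (h : plucker u v ≠ 0) :
    wedgePt (plucker u v) y = 0 ↔ ∃ a b : K, y = a • u + b • v :=
  ⟨exists_comb_of_wedgePt h, by rintro ⟨a, b, rfl⟩; exact wedgePt_plucker_comb u v a b⟩

lemma exists_plucker_eq {w : Fin 6 → K} (hq : plQuad w = 0) :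
    ∃ u v, w = plucker u v := by
  simp only [plQuad] at hq
  by_cases h0 : w 0 ≠ 0
  · refine ⟨![w 0, 0, -w 3, -w 4], ![0, 1, w 1 / w 0, w 2 / w 0], ?_⟩
    ext i; fin_cases i <;> simp [plucker] <;> field_simp <;> linear_combination hq
  by_cases h1 : w 1 ≠ 0
  · refine ⟨![w 1, w 3, 0, -w 5], ![0, w 0 / w 1, 1, w 2 / w 1], ?_⟩
    ext i; fin_cases i <;> simp [plucker] <;> field_simp <;> linear_combination -hq
  by_cases h2 : w 2 ≠ 0
  · refine ⟨![w 2, w 4, w 5, 0], ![0, w 0 / w 2, w 1 / w 2, 1], ?_⟩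
    ext i; fin_cases i <;> simp [plucker] <;> field_simp <;> linear_combination hq
  push Not at h0 h1 h2
  by_cases h3 : w 3 ≠ 0
  · refine ⟨![0, w 3, 0, -w 5], ![0, 0, 1, w 4 / w 3], ?_⟩
    ext i; fin_cases i <;> simp [plucker, h0, h1, h2] <;> field_simp
  by_cases h4 : w 4 ≠ 0
  · refine ⟨![0, w 4, w 5, 0], ![0, 0, w 3 / w 4, 1], ?_⟩
    ext i; fin_cases i <;> simp [plucker, h0, h1, h2] <;> field_simp
  push Not at h3 h4
  refine ⟨![0, 0, w 5, 0], ![0, 0, 0, 1], ?_⟩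
  ext i; fin_cases i <;> simp [plucker, *]

/-! ### Linear changes of coordinates -/

/-- The chain rule for substitutions of polynomials. -/
lemma pderiv_aeval {σ τ : Type*} [Fintype σ] (f : σ → MvPolynomial τ K) (i : τ)
    (p : MvPolynomial σ K) :
    pderiv i (aeval f p) = ∑ j, aeval f (pderiv j p) * pderiv i (f j) := by
  classical
  induction p using MvPolynomial.induction_on with
  | C a => simp [← algebraMap_eq]
  | add p q hp hq => simp only [map_add, hp, hq, add_mul, Finset.sum_add_distrib]
  | mul_X p k hp =>
    simp only [map_mul, aeval_X, Derivation.leibniz, hp, smul_eq_mul, map_add, add_mul,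
      Finset.sum_add_distrib, pderiv_X, Finset.mul_sum]
    congr 1
    · rw [Finset.sum_eq_single k]
      · simp
      · intro j _ hj; simp [hj.symm]
      · simp
    · exact Finset.sum_congr rfl fun j _ => by ring

/-- The substitution `p ↦ p ∘ A` for a linear map `A`. -/
noncomputable def linSubst {n : ℕ} (A : (Fin n → K) →ₗ[K] (Fin n → K)) :
    MvPolynomial (Fin n) K →ₐ[K] MvPolynomial (Fin n) K :=
  aeval fun i => ∑ j, C (A (Pi.single j 1) i) * X j

lemma linearMap_apply_eq_sum {n m : ℕ} (A : (Fin n → K) →ₗ[K] (Fin m → K)) (v : Fin n → K)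
    (i : Fin m) : A v i = ∑ j, A (Pi.single j 1) i * v j := by
  conv_lhs => rw [← Finset.univ_sum_single v, map_sum, Finset.sum_apply]
  refine Finset.sum_congr rfl fun j _ => ?_
  have : (Pi.single j (v j) : Fin n → K) = v j • Pi.single j 1 := by
    rw [← Pi.single_smul, smul_eq_mul, mul_one]
  rw [this, map_smul, Pi.smul_apply, smul_eq_mul, mul_comm]

lemma eval_linSubst {n : ℕ} (A : (Fin n → K) →ₗ[K] (Fin n → K)) (p : MvPolynomial (Fin n) K)
    (v : Fin n → K) : eval v (linSubst A p) = eval (A v) p := by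
  have h : (eval v).comp (linSubst A).toRingHom = eval (A v) := by
    refine MvPolynomial.ringHom_ext (fun r => ?_) fun i => ?_
    · simp [linSubst, ← algebraMap_eq]
    · simp [linSubst, linearMap_apply_eq_sum A v i]
  exact RingHom.congr_fun h p

lemma isHomogeneous_linSubst {n m : ℕ} (A : (Fin n → K) →ₗ[K] (Fin n → K))
    {p : MvPolynomial (Fin n) K} (hp : p.IsHomogeneous m) : (linSubst A p).IsHomogeneous m := by
  have := hp.aeval (n := 1) (fun i => ∑ j, C (A (Pi.single j 1) i) * X j : Fin n → MvPolynomial (Fin n) K)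
    fun i => IsHomogeneous.sum _ _ _ fun j _ => by
      simpa using (isHomogeneous_C (Fin n) (A (Pi.single j 1) i)).mul (isHomogeneous_X K j)
  rwa [one_mul] at this

lemma linSubst_linSubst_symm [Infinite K] {n : ℕ} (A : (Fin n → K) ≃ₗ[K] (Fin n → K))
    (p : MvPolynomial (Fin n) K) :
    linSubst (A : (Fin n → K) →ₗ[K] _) (linSubst (A.symm : (Fin n → K) →ₗ[K] _) p) = p :=
  MvPolynomial.funext fun v => by simp [eval_linSubst]

/-- The algebra automorphism `p ↦ p ∘ A` for a linear automorphism `A`. -/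
noncomputable def linSubstEquiv [Infinite K] {n : ℕ} (A : (Fin n → K) ≃ₗ[K] (Fin n → K)) :
    MvPolynomial (Fin n) K ≃ₐ[K] MvPolynomial (Fin n) K :=
  { linSubst (A : (Fin n → K) →ₗ[K] (Fin n → K)) with
    invFun := linSubst (A.symm : (Fin n → K) →ₗ[K] (Fin n → K))
    left_inv := linSubst_linSubst_symm A.symm
    right_inv := linSubst_linSubst_symm A }

lemma eval_linSubstEquiv [Infinite K] {n : ℕ} (A : (Fin n → K) ≃ₗ[K] (Fin n → K))
    (p : MvPolynomial (Fin n) K) (v : Fin n → K) :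
    eval v (linSubstEquiv A p) = eval (A v) p :=
  eval_linSubst _ p v

lemma projMap_mk {n : ℕ} (A : (Fin n → K) ≃ₗ[K] (Fin n → K)) {v : Fin n → K} (hv : v ≠ 0) :
    projMap A (Projectivization.mk K v hv) =
      Projectivization.mk K (A v) (A.map_ne_zero_iff.2 hv) :=
  Projectivization.map_mk _ _ _ _

lemma projMap_injective {n : ℕ} (A : (Fin n → K) ≃ₗ[K] (Fin n → K)) :
    Function.Injective (projMap A) :=
  Projectivization.map_injective _ _

lemma projMap_surjective {n : ℕ} (A : (Fin n → K) ≃ₗ[K] (Fin n → K)) :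
    Function.Surjective (projMap A) := fun x => by
  induction x using Projectivization.ind with | h v hv => ?_
  refine ⟨Projectivization.mk K (A.symm v) (A.symm.map_ne_zero_iff.2 hv), ?_⟩
  rw [projMap_mk]; simp

lemma projMap_mem_image {n : ℕ} (A : (Fin n → K) ≃ₗ[K] (Fin n → K)) {X : Set (PP K n)}
    {x : PP K n} : projMap A x ∈ projMap A '' X ↔ x ∈ X :=
  (projMap_injective A).mem_set_image

lemma linSubst_mem_homIdeal {n : ℕ} (A : (Fin n → K) ≃ₗ[K] (Fin n → K))
    {X : Set (PP K n)} {p : MvPolynomial (Fin n) K} (hp : p ∈ homIdeal (projMap A '' X)) :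
    linSubst (A : (Fin n → K) →ₗ[K] _) p ∈ homIdeal X := by
  obtain ⟨⟨m, hm⟩, h⟩ := hp
  refine ⟨⟨m, isHomogeneous_linSubst _ hm⟩, fun x hx => ?_⟩
  induction x using Projectivization.ind with | h v hv => ?_
  rw [vanishes_mk (isHomogeneous_linSubst _ hm), eval_linSubst]
  have := h _ (Set.mem_image_of_mem _ hx)
  rwa [projMap_mk, vanishes_mk hm] at this

lemma image_symm_image {n : ℕ} (A : (Fin n → K) ≃ₗ[K] (Fin n → K)) (X : Set (PP K n)) :
    projMap A.symm '' (projMap A '' X) = X := by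
  rw [← Set.image_comp]
  convert Set.image_id X with x
  induction x using Projectivization.ind with | h v hv => ?_
  simp [projMap_mk]

/-- The transpose of a linear map, in the standard basis. -/
def transposeMap {n m : ℕ} (A : (Fin n → K) →ₗ[K] (Fin m → K)) : (Fin m → K) →ₗ[K] (Fin n → K) where
  toFun g i := ∑ j, g j * A (Pi.single i 1) j
  map_add' g h := by ext i; simp [add_mul, Finset.sum_add_distrib]
  map_smul' c g := by ext i; simp [Finset.mul_sum, mul_assoc]

lemma transposeMap_injective {n m : ℕ} (A : (Fin n → K) →ₗ[K] (Fin m → K))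
    (hA : Function.Surjective A) : Function.Injective (transposeMap A) := by
  rw [← LinearMap.ker_eq_bot, LinearMap.ker_eq_bot']
  intro g hg
  ext k
  obtain ⟨v, hv⟩ := hA (Pi.single k 1)
  have h : ∑ i, v i * transposeMap A g i = ∑ j, g j * A v j := by
    simp only [transposeMap, LinearMap.coe_mk, AddHom.coe_mk, Finset.mul_sum,
      linearMap_apply_eq_sum A v]
    rw [Finset.sum_comm]
    exact Finset.sum_congr rfl fun j _ => Finset.sum_congr rfl fun i _ => by ring
  rw [hg, hv] at h
  simpa [Pi.single_apply] using h.symm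

lemma grad_linSubst {n : ℕ} (A : (Fin n → K) →ₗ[K] (Fin n → K)) (p : MvPolynomial (Fin n) K)
    (v : Fin n → K) :
    (fun i => eval v (pderiv i (linSubst A p))) =
      transposeMap A fun i => eval (A v) (pderiv i p) := by
  ext i
  rw [linSubst, pderiv_aeval, map_sum]
  refine Finset.sum_congr rfl fun j _ => ?_
  rw [← linSubst, map_mul, eval_linSubst]
  congr 1
  simp only [map_sum, pderiv_C_mul, pderiv_X, map_mul, eval_C]
  rw [Finset.sum_eq_single i]
  · simp
  · intro k _ hk; simp [hk]
  · simp

lemma gradSpan_eq_map [Infinite K] {n : ℕ} (A : (Fin n → K) ≃ₗ[K] (Fin n → K)) (X : Set (PP K n))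
    (v : Fin n → K) :
    gradSpan X v = (gradSpan (projMap A '' X) (A v)).map
      (transposeMap (A : (Fin n → K) →ₗ[K] (Fin n → K))) := by
  rw [gradSpan, gradSpan, Submodule.map_span]
  congr 1
  ext g
  constructor
  · rintro ⟨p, hp, rfl⟩
    refine ⟨_, ⟨linSubst (A.symm : (Fin n → K) →ₗ[K] _) p, ?_, rfl⟩, ?_⟩
    · apply linSubst_mem_homIdeal
      rwa [image_symm_image]
    · rw [← LinearEquiv.coe_coe, ← grad_linSubst, linSubst_linSubst_symm]
  · rintro ⟨_, ⟨p, hp, rfl⟩, rfl⟩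
    exact ⟨_, linSubst_mem_homIdeal A hp, (grad_linSubst _ p v).symm⟩

lemma finrank_gradSpan_image [Infinite K] {n : ℕ} (A : (Fin n → K) ≃ₗ[K] (Fin n → K))
    (X : Set (PP K n)) (v : Fin n → K) :
    Module.finrank K (gradSpan (projMap A '' X) (A v)) = Module.finrank K (gradSpan X v) := by
  rw [gradSpan_eq_map A X v]
  exact ((Submodule.equivMapOfInjective _ (transposeMap_injective _ A.surjective) _).finrank_eq)

lemma finrank_gradSpan_smul_iff {n : ℕ} (X : Set (PP K n)) {k : ℕ} {v : Fin n → K} (hv : v ≠ 0) :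
    (∀ (u : Fin n → K) (h : u ≠ 0), Projectivization.mk K u h = Projectivization.mk K v hv →
      Module.finrank K (gradSpan X u) = k) ↔ Module.finrank K (gradSpan X v) = k := by
  refine ⟨fun H => H v hv rfl, fun H u hu e => ?_⟩
  obtain ⟨c, rfl⟩ := (Projectivization.mk_eq_mk_iff' K _ _ _ _).1 e
  have hc : c ≠ 0 := by rintro rfl; simp at hu
  have key : ∀ (c : K), c ≠ 0 → ∀ w : Fin n → K, gradSpan X (c • w) ≤ gradSpan X w := by
    intro c hc w
    refine Submodule.span_le.2 ?_
    rintro _ ⟨p, ⟨⟨m, hm⟩, hp⟩, rfl⟩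
    have h : (fun i => eval (c • w) (pderiv i p)) = c ^ (m - 1) • fun i => eval w (pderiv i p) := by
      ext i
      exact eval_smul_of_isHomogeneous hm.pderiv c w
    rw [h]
    exact Submodule.smul_mem _ _ (Submodule.subset_span ⟨p, ⟨⟨m, hm⟩, hp⟩, rfl⟩)
  have h2 := key c⁻¹ (inv_ne_zero hc) (c • v)
  rw [inv_smul_smul₀ hc] at h2
  rw [← H, le_antisymm (key c hc v) h2]

lemma curveSmoothPt_mk {n : ℕ} (X : Set (PP K n)) {v : Fin n → K} (hv : v ≠ 0) :
    CurveSmoothPt X (Projectivization.mk K v hv) ↔ Module.finrank K (gradSpan X v) = n - 2 :=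
  finrank_gradSpan_smul_iff X hv

lemma surfSmoothPt_mk (X : Set (PP K 4)) {v : Fin 4 → K} (hv : v ≠ 0) :
    SurfSmoothPt X (Projectivization.mk K v hv) ↔ Module.finrank K (gradSpan X v) = 1 :=
  finrank_gradSpan_smul_iff X hv

lemma curveSmoothPt_image [Infinite K] {n : ℕ} (A : (Fin n → K) ≃ₗ[K] (Fin n → K))
    (X : Set (PP K n)) (x : PP K n) :
    CurveSmoothPt (projMap A '' X) (projMap A x) ↔ CurveSmoothPt X x := by
  induction x using Projectivization.ind with | h v hv => ?_
  rw [projMap_mk, curveSmoothPt_mk, curveSmoothPt_mk, finrank_gradSpan_image]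

lemma projMap_mem_singLocus_image [Infinite K] (A : (Fin 4 → K) ≃ₗ[K] (Fin 4 → K))
    (X : Set (PP K 4)) (x : PP K 4) :
    projMap A x ∈ singLocus (projMap A '' X) ↔ x ∈ singLocus X := by
  induction x using Projectivization.ind with | h v hv => ?_
  simp only [singLocus, Set.mem_ofPred_eq, projMap_mem_image]
  rw [projMap_mk, surfSmoothPt_mk, surfSmoothPt_mk, finrank_gradSpan_image]

/-! ### The action on bivectors -/

/-- The linear map `Λ²A` in Plücker coordinates. -/
def ext2 (A : (Fin 4 → K) →ₗ[K] (Fin 4 → K)) : (Fin 6 → K) →ₗ[K] (Fin 6 → K) where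
  toFun w :=
    w 0 • plucker (A (Pi.single 0 1)) (A (Pi.single 1 1)) +
    w 1 • plucker (A (Pi.single 0 1)) (A (Pi.single 2 1)) +
    w 2 • plucker (A (Pi.single 0 1)) (A (Pi.single 3 1)) +
    w 3 • plucker (A (Pi.single 1 1)) (A (Pi.single 2 1)) +
    w 4 • plucker (A (Pi.single 1 1)) (A (Pi.single 3 1)) +
    w 5 • plucker (A (Pi.single 2 1)) (A (Pi.single 3 1))
  map_add' w z := by simp only [Pi.add_apply, add_smul]; abel
  map_smul' c w := by simp only [Pi.smul_apply, smul_eq_mul, mul_smul, smul_add, RingHom.id_apply]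

lemma ext2_plucker (A : (Fin 4 → K) →ₗ[K] (Fin 4 → K)) (u v : Fin 4 → K) :
    ext2 A (plucker u v) = plucker (A u) (A v) := by
  have hu := linearMap_apply_eq_sum A u
  have hv := linearMap_apply_eq_sum A v
  simp only [Fin.sum_univ_four] at hu hv
  ext i
  fin_cases i <;> simp [ext2, plucker, hu, hv] <;> ring

lemma linearMap_ext_plucker {f g : (Fin 6 → K) →ₗ[K] (Fin 6 → K)}
    (h : ∀ u v, f (plucker u v) = g (plucker u v)) : f = g := by
  apply LinearMap.pi_ext'
  intro i
  ext1
  have e : ∃ u v : Fin 4 → K, plucker u v = Pi.single i 1 := by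
    fin_cases i
    · refine ⟨![1, 0, 0, 0], ![0, 1, 0, 0], ?_⟩; ext j; fin_cases j <;> simp [plucker]
    · refine ⟨![1, 0, 0, 0], ![0, 0, 1, 0], ?_⟩; ext j; fin_cases j <;> simp [plucker]
    · refine ⟨![1, 0, 0, 0], ![0, 0, 0, 1], ?_⟩; ext j; fin_cases j <;> simp [plucker]
    · refine ⟨![0, 1, 0, 0], ![0, 0, 1, 0], ?_⟩; ext j; fin_cases j <;> simp [plucker]
    · refine ⟨![0, 1, 0, 0], ![0, 0, 0, 1], ?_⟩; ext j; fin_cases j <;> simp [plucker]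
    · refine ⟨![0, 0, 1, 0], ![0, 0, 0, 1], ?_⟩; ext j; fin_cases j <;> simp [plucker]
  obtain ⟨u, v, e⟩ := e
  simpa [e] using h u v

/-- The linear automorphism `Λ²A` in Plücker coordinates. -/
def ext2Equiv (A : (Fin 4 → K) ≃ₗ[K] (Fin 4 → K)) : (Fin 6 → K) ≃ₗ[K] (Fin 6 → K) :=
  LinearEquiv.ofLinearMap (ext2 (A : (Fin 4 → K) →ₗ[K] _)) (ext2 (A.symm : (Fin 4 → K) →ₗ[K] _))
    (linearMap_ext_plucker fun u v => by simp [ext2_plucker])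
    (linearMap_ext_plucker fun u v => by simp [ext2_plucker])

lemma ext2Equiv_plucker (A : (Fin 4 → K) ≃ₗ[K] (Fin 4 → K)) (u v : Fin 4 → K) :
    ext2Equiv A (plucker u v) = plucker (A u) (A v) :=
  ext2_plucker _ u v

lemma ext2Equiv_symm_plucker (A : (Fin 4 → K) ≃ₗ[K] (Fin 4 → K)) (u v : Fin 4 → K) :
    (ext2Equiv A).symm (plucker u v) = plucker (A.symm u) (A.symm v) :=
  ext2_plucker _ u v

lemma plQuad_ext2Equiv (A : (Fin 4 → K) ≃ₗ[K] (Fin 4 → K)) (w : Fin 6 → K) :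
    plQuad (ext2Equiv A w) = 0 ↔ plQuad w = 0 := by
  constructor <;> intro h
  · obtain ⟨u, v, e⟩ := exists_plucker_eq h
    rw [LinearEquiv.eq_symm_apply _ |>.2 e, ext2Equiv_symm_plucker, plQuad_plucker]
  · obtain ⟨u, v, rfl⟩ := exists_plucker_eq h
    rw [ext2Equiv_plucker, plQuad_plucker]

lemma plPair_ext2Equiv (A : (Fin 4 → K) ≃ₗ[K] (Fin 4 → K)) {w z : Fin 6 → K}
    (hw : plQuad w = 0) (hz : plQuad z = 0) :
    plPair (ext2Equiv A w) (ext2Equiv A z) = 0 ↔ plPair w z = 0 := by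
  have h := plQuad_ext2Equiv A (w + z)
  rwa [map_add, plQuad_add, plQuad_add, hw, hz, (plQuad_ext2Equiv A w).2 hw,
    (plQuad_ext2Equiv A z).2 hz, zero_add, zero_add, zero_add] at h

lemma wedgePt_ext2Equiv (A : (Fin 4 → K) ≃ₗ[K] (Fin 4 → K)) {w : Fin 6 → K} (hw : w ≠ 0)
    (hq : plQuad w = 0) (y : Fin 4 → K) :
    wedgePt (ext2Equiv A w) (A y) = 0 ↔ wedgePt w y = 0 := by
  obtain ⟨u, v, rfl⟩ := exists_plucker_eq hq
  have h2 : plucker (A u) (A v) ≠ 0 := by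
    rw [← ext2Equiv_plucker]; exact (ext2Equiv A).map_ne_zero_iff.2 hw
  rw [ext2Equiv_plucker, wedgePt_plucker_eq_zero_iff h2, wedgePt_plucker_eq_zero_iff hw]
  simp_rw [← map_smul, ← map_add, A.injective.eq_iff]

lemma projMap_ext2_mem_grass (A : (Fin 4 → K) ≃ₗ[K] (Fin 4 → K)) (x : PP K 6) :
    projMap (ext2Equiv A) x ∈ grass K ↔ x ∈ grass K := by
  induction x using Projectivization.ind with | h w hw => ?_
  rw [projMap_mk, mk_mem_grass, mk_mem_grass, plQuad_ext2Equiv]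

lemma projMap_mem_lineOf_ext2 (A : (Fin 4 → K) ≃ₗ[K] (Fin 4 → K)) {x : PP K 6}
    (hx : x ∈ grass K) (p : PP K 4) :
    projMap A p ∈ lineOf (projMap (ext2Equiv A) x) ↔ p ∈ lineOf x := by
  induction x using Projectivization.ind with | h w hw => ?_
  induction p using Projectivization.ind with | h y hy => ?_
  rw [projMap_mk, projMap_mk, mk_mem_lineOf, mk_mem_lineOf,
    wedgePt_ext2Equiv A hw ((mk_mem_grass hw).1 hx)]

lemma image_lineOf (A : (Fin 4 → K) ≃ₗ[K] (Fin 4 → K)) {x : PP K 6} (hx : x ∈ grass K) :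
    projMap A '' lineOf x = lineOf (projMap (ext2Equiv A) x) := by
  ext p
  obtain ⟨p, rfl⟩ := projMap_surjective A p
  rw [projMap_mem_image, projMap_mem_lineOf_ext2 A hx]

lemma projMap_ext2_mem_linesOf_image (A : (Fin 4 → K) ≃ₗ[K] (Fin 4 → K)) (S : Set (PP K 4))
    (x : PP K 6) : projMap (ext2Equiv A) x ∈ linesOf (projMap A '' S) ↔ x ∈ linesOf S := by
  simp only [linesOf, Set.mem_ofPred_eq, projMap_ext2_mem_grass]
  refine and_congr_right fun hx => ?_
  rw [← image_lineOf A hx, Set.image_subset_image_iff (projMap_injective A)]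

/-! ### The vanishing ideal of a projective set -/

/-- The ideal of all polynomials vanishing on the affine cone over `X` outside the origin. -/
def vanIdeal {n : ℕ} (X : Set (PP K n)) : Ideal (MvPolynomial (Fin n) K) where
  carrier := {p | ∀ (v : Fin n → K) (hv : v ≠ 0), Projectivization.mk K v hv ∈ X → eval v p = 0}
  add_mem' hp hq v hv h := by rw [map_add, hp v hv h, hq v hv h, add_zero]
  zero_mem' v hv h := map_zero _
  smul_mem' c p hp v hv h := by rw [smul_eq_mul, map_mul, hp v hv h, mul_zero]

lemma mem_vanIdeal {n : ℕ} {X : Set (PP K n)} {p : MvPolynomial (Fin n) K} :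
    p ∈ vanIdeal X ↔
      ∀ (v : Fin n → K) (hv : v ≠ 0), Projectivization.mk K v hv ∈ X → eval v p = 0 :=
  Iff.rfl

lemma eval_weightedHomogeneousComponent_eq_zero [Infinite K] {σ : Type*} (w : σ → ℕ)
    {p : MvPolynomial σ K} {y : σ → K} (h : ∀ c : K, c ≠ 0 → eval (fun i => c ^ w i * y i) p = 0)
    (i : ℕ) : eval y (weightedHomogeneousComponent w i p) = 0 := by
  classical
  have hfin := weightedHomogeneousComponent_finsupp (w := w) p
  set s := hfin.toFinset
  have hsum : p = ∑ j ∈ s, weightedHomogeneousComponent w j p := by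
    conv_lhs => rw [← sum_weightedHomogeneousComponent w p]
    exact finsum_eq_sum _ hfin
  let q : Polynomial K :=
    ∑ j ∈ s, Polynomial.monomial j (eval y (weightedHomogeneousComponent w j p))
  have hq : ∀ c : K, c ≠ 0 → q.eval c = 0 := by
    intro c hc
    rw [← h c hc]
    conv_rhs => rw [hsum]
    simp only [q, Polynomial.eval_finsetSum, Polynomial.eval_monomial, map_sum]
    refine Finset.sum_congr rfl fun j _ => ?_
    rw [eval_weighted_smul (weightedHomogeneousComponent_isWeightedHomogeneous j p), mul_comm]
  have hq0 : q = 0 := by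
    refine Polynomial.eq_zero_of_infinite_isRoot q ?_
    exact (Set.Finite.infinite_compl (Set.finite_singleton (0 : K))).mono fun c hc => hq c hc
  have hc : q.coeff i = 0 := by rw [hq0, Polynomial.coeff_zero]
  simp only [q, Polynomial.finsetSum_coeff, Polynomial.coeff_monomial] at hc
  by_cases hi : i ∈ s
  · simpa [hi] using hc
  · have : weightedHomogeneousComponent w i p = 0 := by
      by_contra h
      exact hi ((Set.Finite.mem_toFinset hfin).2 h)
    rw [this, map_zero]

lemma weightedHomogeneousComponent_mem_vanIdeal [Infinite K] {n : ℕ} {X : Set (PP K n)}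
    (w : Fin n → ℕ)
    (hw : ∀ (c : K) (v u : Fin n → K) (hv : v ≠ 0) (hu : u ≠ 0), c ≠ 0 →
      u = (fun i => c ^ w i * v i) → Projectivization.mk K v hv ∈ X → Projectivization.mk K u hu ∈ X)
    {p : MvPolynomial (Fin n) K} (hp : p ∈ vanIdeal X) (i : ℕ) :
    weightedHomogeneousComponent w i p ∈ vanIdeal X := by
  intro v hv hX
  refine eval_weightedHomogeneousComponent_eq_zero w (fun c hc => ?_) i
  have hu : (fun i => c ^ w i * v i) ≠ 0 := by
    intro h
    apply hv
    ext i
    have := congrFun h i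
    simpa [hc] using this
  exact hp _ hu (hw c v _ hv hu hc rfl hX)

lemma homogeneousComponent_mem_vanIdeal [Infinite K] {n : ℕ} {X : Set (PP K n)}
    {p : MvPolynomial (Fin n) K} (hp : p ∈ vanIdeal X) (i : ℕ) :
    homogeneousComponent i p ∈ vanIdeal X := by
  refine weightedHomogeneousComponent_mem_vanIdeal 1 (fun c v u hv hu hc e hX => ?_) hp i
  have e' : u = c • v := by rw [e]; ext i; simp
  subst e'
  rwa [mk_smul hv]

lemma vanIdeal_isPrime [Infinite K] {n : ℕ} {X : Set (PP K n)} (hX : ZIrred X) :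
    (vanIdeal X).IsPrime := by
  classical
  let _ : GradedAlgebra (homogeneousSubmodule (Fin n) K) := gradedAlgebra
  have hhom : (vanIdeal X).IsHomogeneous (homogeneousSubmodule (Fin n) K) := by
    intro i p hp
    have := homogeneousComponent_mem_vanIdeal hp i
    rwa [← decomposition.decompose'_apply] at this
  refine hhom.isPrime_of_homogeneous_mem_or_mem ?_ ?_
  · rw [Ne, Ideal.eq_top_iff_one]
    intro h
    obtain ⟨x, hx⟩ := hX.1
    induction x using Projectivization.ind with | h v hv => ?_
    simpa using h v hv hx
  · rintro p q ⟨i, hp⟩ ⟨j, hq⟩ hpq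
    rw [mem_homogeneousSubmodule] at hp hq
    have closed : ∀ {r : MvPolynomial (Fin n) K} {k : ℕ}, r.IsHomogeneous k →
        ZClosed (zeroLocus {r}) := fun {r k} hr => ⟨{r}, by rintro _ rfl; exact ⟨k, hr⟩, rfl⟩
    have mem : ∀ {r : MvPolynomial (Fin n) K} {k : ℕ}, r.IsHomogeneous k →
        X ⊆ zeroLocus {r} → r ∈ vanIdeal X := fun {r k} hr h v hv hvX => h hvX r rfl v hv rfl
    refine (hX.2 _ _ (closed hp) (closed hq) fun x hx => ?_).imp (mem hp) (mem hq)
    induction x using Projectivization.ind with | h v hv => ?_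
    have h := hpq v hv hx
    rw [map_mul, mul_eq_zero] at h
    refine h.imp (fun h => ?_) fun h => ?_
    · rintro _ rfl; rwa [vanishes_mk hp]
    · rintro _ rfl; rwa [vanishes_mk hq]

lemma vanIdeal_anti {n : ℕ} {X Y : Set (PP K n)} (h : X ⊆ Y) : vanIdeal Y ≤ vanIdeal X :=
  fun _ hp v hv hX => hp v hv (h hX)

lemma mk_mem_of_vanIdeal {n : ℕ} {X : Set (PP K n)} (hX : ZClosed X) {v : Fin n → K} (hv : v ≠ 0)
    (h : ∀ p ∈ vanIdeal X, eval v p = 0) : Projectivization.mk K v hv ∈ X := by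
  obtain ⟨T, hT, rfl⟩ := hX
  intro p hp
  obtain ⟨m, hm⟩ := hT p hp
  rw [vanishes_mk hm]
  exact h p fun u hu hX => hX p hp u hu rfl

lemma vanIdeal_lt {n : ℕ} {X Y : Set (PP K n)} (hX : ZClosed X) (h : X < Y) :
    vanIdeal Y < vanIdeal X := by
  refine lt_of_le_of_ne (vanIdeal_anti h.le) fun e => h.not_ge fun y hy => ?_
  induction y using Projectivization.ind with | h v hv => ?_
  refine mk_mem_of_vanIdeal hX hv fun p hp => ?_
  rw [← e] at hp
  exact hp v hv hy

lemma vanIdeal_lt_ker_eval_zero [Infinite K] {n : ℕ} {X : Set (PP K n)} (hX : X.Nonempty) :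
    vanIdeal X < RingHom.ker (eval (0 : Fin n → K)) := by
  obtain ⟨x, hx⟩ := hX
  induction x using Projectivization.ind with | h v hv => ?_
  refine SetLike.lt_iff_le_and_exists.2 ⟨fun p hp => ?_, ?_⟩
  · have h := homogeneousComponent_mem_vanIdeal hp 0 v hv hx
    rw [homogeneousComponent_zero, eval_C] at h
    rw [RingHom.mem_ker, eval_zero, constantCoeff_eq, h]
  · obtain ⟨i, hi⟩ := Function.ne_iff.1 hv
    refine ⟨MvPolynomial.X i, by simp [RingHom.mem_ker], fun h => hi ?_⟩
    simpa using h v hv hx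

/-- The vanishing ideal of an irreducible surface in `ℙ³` is generated by a prime element. -/
lemma exists_prime_vanIdeal [Infinite K] {S : Set (PP K 4)} (hS : ZIrred S)
    (hdim : dimGE S 2) (hne : vanIdeal S ≠ ⊥) :
    ∃ F : MvPolynomial (Fin 4) K, Prime F ∧ ∀ p, p ∈ vanIdeal S ↔ F ∣ p := by
  have hprime := vanIdeal_isPrime hS
  obtain ⟨F, hF, hFp⟩ := hprime.exists_mem_prime_of_ne_bot hne
  refine ⟨F, hFp, fun p => ?_⟩
  have hle : Ideal.span {F} ≤ vanIdeal S := (Ideal.span_singleton_le_iff_mem _).2 hF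
  rcases hle.eq_or_lt with e | hlt
  · rw [← e, Ideal.mem_span_singleton]
  exfalso
  obtain ⟨f, hf, hmono⟩ := hdim
  have p1 : (Ideal.span {F}).IsPrime := (Ideal.span_singleton_prime hFp.ne_zero).2 hFp
  have l0 : (⊥ : Ideal (MvPolynomial (Fin 4) K)) < Ideal.span {F} :=
    bot_lt_iff_ne_bot.2 (by simpa using hFp.ne_zero)
  have l2 : vanIdeal S < vanIdeal (f 1) :=
    (vanIdeal_anti (hf 2).2.2).trans_lt (vanIdeal_lt (hf 1).1 (hmono (by decide)))
  have l3 : vanIdeal (f 1) < vanIdeal (f 0) := vanIdeal_lt (hf 0).1 (hmono (by decide))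
  have l4 := vanIdeal_lt_ker_eval_zero (hf 0).2.1.1
  have pM : (RingHom.ker (eval (0 : Fin 4 → K))).IsPrime := RingHom.ker_isPrime _
  let s : LTSeries (PrimeSpectrum (MvPolynomial (Fin 4) K)) :=
    { length := 5
      toFun := ![⟨⊥, Ideal.isPrime_bot⟩, ⟨_, p1⟩, ⟨_, hprime⟩, ⟨_, vanIdeal_isPrime (hf 1).2.1⟩,
        ⟨_, vanIdeal_isPrime (hf 0).2.1⟩, ⟨_, pM⟩]
      step := by
        intro i
        fin_cases i
        · exact l0
        · exact hlt
        · exact l2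
        · exact l3
        · exact l4 }
  have h1 := Order.LTSeries.length_le_krullDim s
  have h2 : ringKrullDim (MvPolynomial (Fin 4) K) = 4 := by
    rw [MvPolynomial.ringKrullDim_of_isNoetherianRing, ringKrullDim_eq_zero_of_field]
    simp
  rw [ringKrullDim] at h2
  rw [h2] at h1
  have h3 : ((5 : ℕ) : WithBot ℕ∞) ≤ ((4 : ℕ) : WithBot ℕ∞) := h1
  have := Nat.cast_le.1 h3
  omega

/-- A torus-invariant hypersurface has a weighted homogeneous equation. -/
lemma exists_isWeightedHomogeneous [Infinite K] {n : ℕ} {S : Set (PP K n)}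
    {F : MvPolynomial (Fin n) K} (hF0 : F ≠ 0) (hF : ∀ p, p ∈ vanIdeal S ↔ F ∣ p) (w : Fin n → ℕ)
    (hw : ∀ (c : K) (v u : Fin n → K) (hv : v ≠ 0) (hu : u ≠ 0), c ≠ 0 →
      u = (fun i => c ^ w i * v i) →
        Projectivization.mk K v hv ∈ S → Projectivization.mk K u hu ∈ S) :
    ∃ m, IsWeightedHomogeneous w F m := by
  classical
  have hmem := weightedHomogeneousComponent_mem_vanIdeal w hw ((hF F).2 dvd_rfl)
  have hex : ∃ m, weightedHomogeneousComponent w m F ≠ 0 := by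
    by_contra! h
    apply hF0
    rw [← sum_weightedHomogeneousComponent w F]
    simp [h]
  obtain ⟨m, hm⟩ := hex
  obtain ⟨G, hG⟩ := (hF _).1 (hmem m)
  have hG0 : G ≠ 0 := by rintro rfl; exact hm (by rw [hG, mul_zero])
  have hdeg : (weightedHomogeneousComponent w m F).totalDegree ≤ F.totalDegree := by
    refine Finset.sup_mono ?_
    rw [support_weightedHomogeneousComponent]
    exact Finset.filter_subset _ _
  rw [hG, totalDegree_mul_of_isDomain hF0 hG0] at hdeg
  have hG1 : G = C (coeff 0 G) := totalDegree_eq_zero_iff_eq_C.1 (by omega)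
  have hc : coeff 0 G ≠ 0 := fun h => hG0 (by rw [hG1, h, C_0])
  refine ⟨m, ?_⟩
  have : F = C (coeff 0 G)⁻¹ * weightedHomogeneousComponent w m F := by
    conv_rhs => rw [hG, hG1]
    rw [mul_left_comm, coeff_C]
    simp only [if_true, ← C_mul, inv_mul_cancel₀ hc, C_1, mul_one]
  rw [this]
  exact (weightedHomogeneousComponent_isWeightedHomogeneous m F).C_mul _

lemma exists_isHomogeneous_of_vanIdeal [Infinite K] {n : ℕ} {S : Set (PP K n)}
    {F : MvPolynomial (Fin n) K} (hF0 : F ≠ 0) (hF : ∀ p, p ∈ vanIdeal S ↔ F ∣ p) :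
    ∃ m, F.IsHomogeneous m := by
  refine exists_isWeightedHomogeneous hF0 hF 1 fun c v u hv hu hc e hX => ?_
  have e' : u = c • v := by rw [e]; ext i; simp
  subst e'
  rwa [mk_smul hv]

lemma mk_mem_iff_of_vanIdeal {n : ℕ} {S : Set (PP K n)} (hS : ZClosed S)
    {F : MvPolynomial (Fin n) K} (hF : ∀ p, p ∈ vanIdeal S ↔ F ∣ p) {v : Fin n → K} (hv : v ≠ 0) :
    Projectivization.mk K v hv ∈ S ↔ eval v F = 0 := by
  refine ⟨fun h => (hF F).2 dvd_rfl v hv h, fun h => mk_mem_of_vanIdeal hS hv fun p hp => ?_⟩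
  obtain ⟨q, rfl⟩ := (hF p).1 hp
  rw [map_mul, h, zero_mul]

/-! ### The degree of a hypersurface -/

/-- The restriction of `p` to the parametrized line `T ↦ y + T q`. -/
noncomputable def lineSubst {σ : Type*} {A : Type*} [CommRing A] [Algebra K A] (y : σ → A)
    (q : σ → K) : MvPolynomial σ K →ₐ[K] Polynomial A :=
  aeval fun i => Polynomial.C (y i) + Polynomial.C (algebraMap K A (q i)) * Polynomial.X

lemma lineSubst_X {σ A : Type*} [CommRing A] [Algebra K A] (y : σ → A) (q : σ → K) (i : σ) :
    lineSubst y q (X i) =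
      Polynomial.C (y i) + Polynomial.C (algebraMap K A (q i)) * Polynomial.X :=
  aeval_X _ i

lemma natDegree_coeff_lineSubst_monomial {σ A : Type*} [CommRing A] [Algebra K A] (y : σ → A)
    (q : σ → K) (m : σ →₀ ℕ) :
    (lineSubst y q (monomial m 1)).natDegree ≤ m.degree ∧
    (lineSubst y q (monomial m 1)).coeff m.degree = algebraMap K A (eval q (monomial m 1)) := by
  induction m using Finsupp.induction_linear with
  | zero => simp
  | add f g hf hg =>
    have e : (monomial (f + g) (1 : K)) = monomial f 1 * monomial g 1 := by
      rw [monomial_mul, one_mul]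
    rw [e, map_mul, map_mul, map_mul, map_add]
    exact ⟨Polynomial.natDegree_mul_le_of_le hf.1 hg.1, by
      rw [Polynomial.coeff_mul_add_eq_of_natDegree_le hf.1 hg.1, hf.2, hg.2]⟩
  | single i k =>
    have e : (monomial (Finsupp.single i k) (1 : K)) = X i ^ k := by rw [X_pow_eq_monomial]
    have hd : (lineSubst y q (X i)).natDegree ≤ 1 := by
      rw [lineSubst_X]; compute_degree
    rw [e, map_pow, map_pow, map_pow, Finsupp.degree_single]
    refine ⟨by simpa using Polynomial.natDegree_pow_le_of_le k hd, ?_⟩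
    have := Polynomial.coeff_pow_of_natDegree_le (m := k) hd
    rw [mul_one] at this
    rw [this, lineSubst_X]
    simp

lemma lineSubst_natDegree_coeff {σ A : Type*} [CommRing A] [Algebra K A] (y : σ → A)
    (q : σ → K) {p : MvPolynomial σ K} {e : ℕ} (hp : p.IsHomogeneous e) :
    (lineSubst y q p).natDegree ≤ e ∧
    (lineSubst y q p).coeff e = algebraMap K A (eval q p) := by
  have key : ∀ m ∈ p.support, (lineSubst y q (monomial m (coeff m p))).natDegree ≤ e ∧
      (lineSubst y q (monomial m (coeff m p))).coeff e =
        algebraMap K A (eval q (monomial m (coeff m p))) := by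
    intro m hm
    have hdeg : m.degree = e := by
      rw [Finsupp.degree_eq_weight_one]
      exact hp (mem_support_iff.1 hm)
    obtain ⟨h1, h2⟩ := natDegree_coeff_lineSubst_monomial y q m
    have hC : monomial m (coeff m p) = coeff m p • monomial m (1 : K) := by
      rw [smul_monomial, smul_eq_mul, mul_one]
    rw [hdeg] at h1 h2
    rw [hC, map_smul]
    refine ⟨(Polynomial.natDegree_smul_le _ _).trans h1, ?_⟩
    rw [Polynomial.coeff_smul, h2, smul_eval, map_mul, Algebra.smul_def]
  conv => rw [p.as_sum]
  simp only [map_sum, Polynomial.finsetSum_coeff]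
  exact ⟨Polynomial.natDegree_sum_le_of_forall_le _ _ fun m hm => (key m hm).1,
    Finset.sum_congr rfl fun m hm => (key m hm).2⟩

lemma eval_lineSubst {σ : Type*} (y q : σ → K) (p : MvPolynomial σ K) (t : K) :
    (lineSubst y q p).eval t = eval (y + t • q) p := by
  have h : (Polynomial.evalRingHom t).comp (lineSubst y q).toRingHom = eval (y + t • q) := by
    refine MvPolynomial.ringHom_ext (fun r => ?_) fun i => ?_
    · have := (lineSubst (A := K) y q).commutes r
      rw [algebraMap_eq] at this
      simp [this]
    · simp [lineSubst_X]; ring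
  exact RingHom.congr_fun h p

lemma map_lineSubst {σ : Type*} (q x : σ → K) (p : MvPolynomial σ K) :
    (lineSubst (A := MvPolynomial σ K) X q p).map (eval x) = lineSubst x q p := by
  have h : (Polynomial.mapRingHom (eval x)).comp (lineSubst (A := MvPolynomial σ K) X q).toRingHom =
      (lineSubst x q).toRingHom := by
    refine MvPolynomial.ringHom_ext (fun r => ?_) fun i => ?_
    · have h1 := (lineSubst (A := MvPolynomial σ K) X q).commutes r
      have h2 := (lineSubst (A := K) x q).commutes r
      rw [algebraMap_eq] at h1 h2
      simp only [RingHom.comp_apply, AlgHom.toRingHom_eq_coe, RingHom.coe_coe, h1, h2]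
      simp [Polynomial.algebraMap_apply, algebraMap_eq]
    · simp [lineSubst_X, algebraMap_eq]
  exact RingHom.congr_fun h p

lemma derivative_lineSubst {σ : Type*} [Fintype σ] (y q : σ → K) (p : MvPolynomial σ K) :
    Polynomial.derivative (lineSubst y q p) =
      ∑ j, lineSubst y q (pderiv j p) * Polynomial.C (q j) := by
  classical
  induction p using MvPolynomial.induction_on with
  | C a =>
    have := (lineSubst (A := K) y q).commutes a
    rw [algebraMap_eq] at this
    simp [this]
  | add p r hp hr => simp only [map_add, hp, hr, add_mul, Finset.sum_add_distrib]
  | mul_X p k hp =>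
    have hX : Polynomial.derivative (lineSubst y q (X k)) = Polynomial.C (q k) := by
      rw [lineSubst_X]; simp
    simp only [map_mul, Polynomial.derivative_mul, hX, hp, Derivation.leibniz, smul_eq_mul, map_add,
      add_mul, Finset.sum_add_distrib, pderiv_X, Finset.sum_mul]
    rw [add_comm]
    refine congrArg₂ (· + ·) ?_ ?_
    · rw [Finset.sum_eq_single k]
      · simp
      · intro j _ hj; simp [hj.symm]
      · simp
    · exact Finset.sum_congr rfl fun j _ => by ring

/-- The automorphism `x ↦ x + T q` of `K[x][T]`. -/
noncomputable def shearHom {σ : Type*} (q : σ → K) :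
    Polynomial (MvPolynomial σ K) →+* Polynomial (MvPolynomial σ K) :=
  Polynomial.eval₂RingHom (lineSubst (A := MvPolynomial σ K) X q).toRingHom Polynomial.X

lemma shearHom_C {σ : Type*} (q : σ → K) (p : MvPolynomial σ K) :
    shearHom q (Polynomial.C p) = lineSubst X q p := by
  simp [shearHom]

lemma shearHom_shearHom_neg {σ : Type*} (q : σ → K) (f : Polynomial (MvPolynomial σ K)) :
    shearHom q (shearHom (-q) f) = f := by
  have hc : ∀ (q : σ → K) (a : K),
      lineSubst (A := MvPolynomial σ K) X q (C a) = Polynomial.C (C a) := by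
    intro q a
    have := (lineSubst (A := MvPolynomial σ K) X q).commutes a
    rwa [algebraMap_eq, Polynomial.algebraMap_apply, algebraMap_eq] at this
  have hX : ∀ q : σ → K, shearHom q Polynomial.X = Polynomial.X := fun q => by simp [shearHom]
  have h : (shearHom q).comp (shearHom (-q)) = RingHom.id _ := by
    refine Polynomial.ringHom_ext' ?_ ?_
    · refine MvPolynomial.ringHom_ext (fun a => ?_) fun i => ?_
      · simp [shearHom_C, hc]
      · simp [shearHom_C, lineSubst_X, hX, algebraMap_eq, hc]
    · simp [hX]
  exact RingHom.congr_fun h f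

lemma prime_lineSubst {σ : Type*} (q : σ → K) {F : MvPolynomial σ K} (hF : Prime F) :
    Prime (lineSubst (A := MvPolynomial σ K) X q F) := by
  let e : Polynomial (MvPolynomial σ K) ≃+* Polynomial (MvPolynomial σ K) :=
    { shearHom q with
      invFun := shearHom (-q)
      left_inv := fun f => by simpa using shearHom_shearHom_neg (-q) f
      right_inv := shearHom_shearHom_neg q }
  have h : Prime (e (Polynomial.C F)) :=
    (MulEquiv.prime_iff e).2 (Polynomial.prime_C_iff.2 hF)
  have h2 : e (Polynomial.C F) = lineSubst (A := MvPolynomial σ K) X q F := shearHom_C q F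
  rwa [h2] at h

/-- Over a perfect field, a prime polynomial has a nonzero partial derivative. -/
lemma exists_pderiv_ne_zero [IsAlgClosed K] {σ : Type*} {F : MvPolynomial σ K} (hF : Prime F) :
    ∃ i, pderiv i F ≠ 0 := by
  classical
  by_contra! h
  have hm : ∀ m ∈ F.support, ∀ i, (m i : K) = 0 := by
    intro m hm i
    by_cases hi : m i = 0
    · simp [hi]
    have e : m = (m - Finsupp.single i 1) + Finsupp.single i 1 := by
      ext j
      by_cases hj : i = j
      · subst hj; simp; omega
      · simp [hj]
    have h1 := coeff_pderiv (i := i) F (m - Finsupp.single i 1)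
    rw [h i, coeff_zero, ← e] at h1
    have h2 := (mul_eq_zero.1 h1.symm).resolve_left (mem_support_iff.1 hm)
    have h3 : (m i : K) = ((m i - 1 : ℕ) : K) + 1 := by
      rw [← Nat.cast_succ]; congr; omega
    rw [h3]
    simpa using h2
  obtain ⟨p, hp⟩ := CharP.exists K
  rcases CharP.char_is_prime_or_zero K p with hpp | rfl
  · have : Fact p.Prime := ⟨hpp⟩
    have hroot : ∀ c : K, ∃ b, b ^ p = c := fun c => IsAlgClosed.exists_pow_nat_eq c hpp.pos
    choose r hr using hroot
    have hdiv : ∀ m ∈ F.support, ∀ i, m i / p * p = m i := fun m hm' i =>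
      Nat.div_mul_cancel ((CharP.cast_eq_zero_iff K p _).1 (hm m hm' i))
    let G : MvPolynomial σ K := ∑ m ∈ F.support,
      monomial (m.mapRange (fun k => k / p) (Nat.zero_div p)) (r (coeff m F))
    have hG : G ^ p = F := by
      have : CharP (MvPolynomial σ K) p := inferInstance
      rw [sum_pow_char p]
      conv_rhs => rw [F.as_sum]
      refine Finset.sum_congr rfl fun m hm' => ?_
      rw [monomial_pow, hr]
      have hm2 : p • m.mapRange (fun k => k / p) (Nat.zero_div p) = m := by
        ext i
        simpa [mul_comm] using hdiv m hm' i
      rw [hm2]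
    exact not_irreducible_pow hpp.one_lt.ne' (hG ▸ hF.irreducible)
  · have : CharZero K := CharP.charP_to_charZero K
    have hC : F = C (coeff 0 F) := by
      ext m
      rw [coeff_C]
      split_ifs with h0
      · rw [h0]
      · by_contra hne
        apply h0
        ext i
        exact (Nat.cast_eq_zero.1 (hm m (mem_support_iff.2 hne) i)).symm
    have h0 : coeff 0 F ≠ 0 := fun h0 => hF.ne_zero (by rw [hC, h0, C_0])
    apply hF.not_isUnit
    rw [hC]
    exact (isUnit_iff_ne_zero.2 h0).map C

/-- A general line meets an irreducible hypersurface transversally. -/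
lemma exists_separable_lineSubst [IsAlgClosed K] {n e : ℕ} {F : MvPolynomial (Fin n) K}
    (hF : Prime F) (hhom : F.IsHomogeneous e) :
    ∃ q x : Fin n → K, eval q F ≠ 0 ∧ (lineSubst x q F).Separable := by
  classical
  obtain ⟨i, hi⟩ := exists_pderiv_ne_zero hF
  have exists_ne : ∀ {p : MvPolynomial (Fin n) K}, p ≠ 0 → ∃ x, eval x p ≠ 0 := by
    intro p hp
    by_contra! h
    exact hp (MvPolynomial.funext fun x => by rw [h x, map_zero])
  obtain ⟨x0, hx0⟩ := exists_ne hi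
  let G : MvPolynomial (Fin n) K := ∑ j, C (eval x0 (pderiv j F)) * X j
  have hG : G ≠ 0 := by
    intro h
    apply hx0
    have := congrArg (eval (Pi.single i 1)) h
    simpa [G, Pi.single_apply] using this
  obtain ⟨q, hq⟩ := exists_ne (mul_ne_zero hF.ne_zero hG)
  rw [map_mul, mul_ne_zero_iff] at hq
  set Φ := lineSubst (A := MvPolynomial (Fin n) K) X q F with hΦ
  have hirr : Irreducible Φ := (prime_lineSubst q hF).irreducible
  have hprim : Φ.IsPrimitive := by
    intro r hr
    have h1 := (Polynomial.C_dvd_iff_dvd_coeff _ _).1 hr e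
    rw [(lineSubst_natDegree_coeff (A := MvPolynomial (Fin n) K) X q hhom).2] at h1
    exact isUnit_of_dvd_unit h1 ((isUnit_iff_ne_zero.2 hq.1).map _)
  let L := FractionRing (MvPolynomial (Fin n) K)
  have hinj : Function.Injective (algebraMap (MvPolynomial (Fin n) K) L) := IsFractionRing.injective _ _
  have hirr' : Irreducible (Φ.map (algebraMap (MvPolynomial (Fin n) K) L)) :=
    hprim.irreducible_iff_irreducible_map_fraction_map.1 hirr
  have hder : Polynomial.derivative Φ ≠ 0 := by
    intro h
    apply hq.2
    have h1 := congrArg (fun f => (Polynomial.map (eval x0) f).eval 0) h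
    simp only [← Polynomial.derivative_map, hΦ, map_lineSubst, derivative_lineSubst,
      Polynomial.eval_finsetSum, Polynomial.eval_mul, eval_lineSubst, Polynomial.eval_C,
      zero_smul, add_zero, Polynomial.map_zero, Polynomial.eval_zero] at h1
    simpa [G] using h1
  have hsep : (Φ.map (algebraMap (MvPolynomial (Fin n) K) L)).Separable := by
    rw [Polynomial.separable_iff_derivative_ne_zero hirr', Polynomial.derivative_map]
    exact (Polynomial.map_ne_zero_iff hinj).2 hder
  obtain ⟨a, b, hab⟩ := hsep
  obtain ⟨s, hs, ha⟩ :=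
    IsLocalization.integerNormalization_spec (nonZeroDivisors (MvPolynomial (Fin n) K)) a
  obtain ⟨t, ht, hb⟩ :=
    IsLocalization.integerNormalization_spec (nonZeroDivisors (MvPolynomial (Fin n) K)) b
  set a' := IsLocalization.integerNormalization (nonZeroDivisors (MvPolynomial (Fin n) K)) a
  set b' := IsLocalization.integerNormalization (nonZeroDivisors (MvPolynomial (Fin n) K)) b
  have hst : s * t ≠ 0 := mul_ne_zero (nonZeroDivisors.ne_zero hs) (nonZeroDivisors.ne_zero ht)
  have hrel : Polynomial.C t * a' * Φ + Polynomial.C s * b' * Polynomial.derivative Φ =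
      Polynomial.C (s * t) := by
    apply Polynomial.map_injective _ hinj
    simp only [Polynomial.map_add, Polynomial.map_mul, Polynomial.map_C, ha, hb,
      ← Polynomial.derivative_map, Algebra.smul_def, map_mul, Polynomial.algebraMap_apply]
    rw [Polynomial.derivative_map] at hab ⊢
    linear_combination Polynomial.C (algebraMap (MvPolynomial (Fin n) K) L s) *
      Polynomial.C (algebraMap (MvPolynomial (Fin n) K) L t) * hab
  obtain ⟨x, hx⟩ := exists_ne hst
  refine ⟨q, x, hq.1, ?_⟩
  have h2 := congrArg (Polynomial.map (eval x)) hrel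
  simp only [Polynomial.map_add, Polynomial.map_mul, ← Polynomial.derivative_map, Polynomial.map_C,
    hΦ, map_lineSubst] at h2
  refine ⟨Polynomial.C (eval x (s * t))⁻¹ * (Polynomial.C (eval x t) * a'.map (eval x)),
    Polynomial.C (eval x (s * t))⁻¹ * (Polynomial.C (eval x s) * b'.map (eval x)), ?_⟩
  rw [mul_assoc, mul_assoc (Polynomial.C (eval x (s * t))⁻¹), ← mul_add, h2, ← Polynomial.C_mul,
    inv_mul_cancel₀ hx, Polynomial.C_1]

lemma lineOfRep_smul {c : K} (hc : c ≠ 0) (w : Fin 6 → K) : lineOfRep (c • w) = lineOfRep w := by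
  ext p
  induction p using Projectivization.ind with | h v hv => ?_
  rw [mk_mem_lineOfRep, mk_mem_lineOfRep, wedgePt_smul_left, smul_eq_zero_iff_right hc]

lemma mul_eq_mul_of_plucker_eq_zero {u v : Fin 4 → K} (h : plucker u v = 0) (i j : Fin 4) :
    u i * v j = u j * v i := by
  have h0 := congrFun h 0
  have h1 := congrFun h 1
  have h2 := congrFun h 2
  have h3 := congrFun h 3
  have h4 := congrFun h 4
  have h5 := congrFun h 5
  simp only [plucker, Matrix.cons_val, Pi.zero_apply, sub_eq_zero] at h0 h1 h2 h3 h4 h5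
  fin_cases i <;> fin_cases j <;> simp [*]

lemma exists_smul_of_plucker_eq_zero {u v : Fin 4 → K} (hv : v ≠ 0) (h : plucker u v = 0) :
    ∃ c : K, u = c • v := by
  obtain ⟨i, hi⟩ := Function.ne_iff.1 hv
  refine ⟨u i / v i, ?_⟩
  ext j
  have := mul_eq_mul_of_plucker_eq_zero h i j
  simp only [Pi.zero_apply] at hi
  simp only [Pi.smul_apply, smul_eq_mul]
  field_simp
  linear_combination -this

/-- The number of intersection points of a hypersurface and a line not contained in it. -/
lemma ncard_inter_lineOfRep [DecidableEq K] {S : Set (PP K 4)} {F : MvPolynomial (Fin 4) K} {e : ℕ}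
    (hhom : F.IsHomogeneous e)
    (hS : ∀ (v : Fin 4 → K) (hv : v ≠ 0), Projectivization.mk K v hv ∈ S ↔ eval v F = 0)
    {r q : Fin 4 → K} (hrq : plucker r q ≠ 0) (hq : eval q F ≠ 0) :
    (S ∩ lineOfRep (plucker r q)).ncard = (lineSubst r q F).roots.toFinset.card := by
  have hf0 : lineSubst r q F ≠ 0 := by
    intro h
    have := (lineSubst_natDegree_coeff r q hhom).2
    rw [h] at this
    exact hq (by simpa using this.symm)
  have hne : ∀ t : K, r + t • q ≠ 0 := by
    intro t h
    have := comb_eq_zero hrq (a := 1) (b := t) (by rwa [one_smul])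
    exact one_ne_zero this.1
  have himg : S ∩ lineOfRep (plucker r q) =
      (fun t => Projectivization.mk K (r + t • q) (hne t)) '' ↑(lineSubst r q F).roots.toFinset := by
    ext p
    induction p using Projectivization.ind with | h v hv => ?_
    simp only [Set.mem_inter_iff, hS, mk_mem_lineOfRep, wedgePt_plucker_eq_zero_iff hrq,
      Set.mem_image, Finset.mem_coe, Multiset.mem_toFinset, Polynomial.mem_roots hf0,
      Polynomial.IsRoot.def, eval_lineSubst]
    constructor
    · rintro ⟨h1, a, b, rfl⟩
      have ha : a ≠ 0 := by
        rintro rfl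
        have hb : b ≠ 0 := by rintro rfl; simp at hv
        rw [zero_smul, zero_add, eval_smul_of_isHomogeneous hhom] at h1
        simp [hb, hq] at h1
      have e1 : a • r + b • q = a • (r + (b / a) • q) := by
        rw [smul_add, smul_smul, mul_div_cancel₀ _ ha]
      refine ⟨b / a, ?_, ?_⟩
      · rw [e1, eval_smul_of_isHomogeneous hhom] at h1
        simpa [ha] using h1
      · rw [eq_comm, Projectivization.mk_eq_mk_iff']
        exact ⟨a, e1.symm⟩
    · rintro ⟨t, ht, h⟩
      obtain ⟨c, rfl⟩ := (Projectivization.mk_eq_mk_iff' K _ _ _ _).1 h.symm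
      refine ⟨?_, c, c * t, by rw [smul_add, smul_smul]⟩
      rw [eval_smul_of_isHomogeneous hhom, ht, mul_zero]
  rw [himg, Set.ncard_image_of_injective, Set.ncard_coe_finset]
  intro t t' h
  obtain ⟨c, hc⟩ := (Projectivization.mk_eq_mk_iff' K _ _ _ _).1 h
  have := comb_eq_zero hrq (a := c - 1) (b := c * t' - t) (by
    rw [smul_add, smul_smul] at hc
    rw [sub_smul, sub_smul, one_smul]
    linear_combination hc)
  have hc1 : c = 1 := sub_eq_zero.1 this.1
  have := this.2
  rw [hc1, one_mul, sub_eq_zero] at this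
  exact this.symm

/-- The degree of a surface is the degree of its equation. -/
lemma degree_eq_of_hasSurfDeg [IsAlgClosed K] {S : Set (PP K 4)} {F : MvPolynomial (Fin 4) K}
    {d e : ℕ} (hd : 2 ≤ d) (hF : Prime F) (hhom : F.IsHomogeneous e)
    (hS : ∀ (v : Fin 4 → K) (hv : v ≠ 0), Projectivization.mk K v hv ∈ S ↔ eval v F = 0)
    (hdeg : HasSurfDeg S d) : e = d := by
  classical
  have hle : d ≤ e := by
    obtain ⟨w, ⟨hw0, hwq⟩, hnot, hcard⟩ := hdeg.2
    obtain ⟨u, v, rfl⟩ := exists_plucker_eq hwq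
    obtain ⟨p, hp, hpS⟩ := Set.not_subset.1 hnot
    induction p using Projectivization.ind with | h q hq => ?_
    rw [mk_mem_lineOfRep, wedgePt_plucker_eq_zero_iff hw0] at hp
    obtain ⟨a, b, hab⟩ := hp
    rw [hS] at hpS
    have hr : ∃ (r : Fin 4 → K) (c : K), c ≠ 0 ∧ plucker r q = c • plucker u v := by
      by_cases ha : a = 0
      · refine ⟨(1 : K) • u + (0 : K) • v, b, ?_, ?_⟩
        · rintro rfl; simp [ha] at hab; exact hq hab
        · rw [hab, plucker_comb]; simp
      · refine ⟨(0 : K) • u + (1 : K) • v, -a, neg_ne_zero.2 ha, ?_⟩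
        rw [hab, plucker_comb]; simp
    obtain ⟨r, c, hc, hrq⟩ := hr
    rw [← lineOfRep_smul hc, ← hrq, ncard_inter_lineOfRep hhom hS
      (by rw [hrq]; exact smul_ne_zero hc hw0) hpS] at hcard
    rw [← hcard]
    exact (Multiset.toFinset_card_le _).trans ((Polynomial.card_roots' _).trans
      (lineSubst_natDegree_coeff r q hhom).1)
  refine le_antisymm ?_ hle
  obtain ⟨q, r, hq, hsep⟩ := exists_separable_lineSubst hF hhom
  have hnat : (lineSubst r q F).natDegree = e := by
    refine le_antisymm (lineSubst_natDegree_coeff r q hhom).1 ?_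
    refine Polynomial.le_natDegree_of_ne_zero ?_
    rw [(lineSubst_natDegree_coeff r q hhom).2]
    exact hq
  have hcard : (lineSubst r q F).roots.toFinset.card = e := by
    rw [Multiset.toFinset_card_of_nodup (Polynomial.nodup_roots hsep),
      ← (IsAlgClosed.splits _).natDegree_eq_card_roots, hnat]
  have he : e ≠ 0 := by omega
  have hq0 : q ≠ 0 := by
    rintro rfl
    apply hq
    have := eval_smul_of_isHomogeneous hhom 0 (0 : Fin 4 → K)
    rwa [smul_zero, zero_pow he, zero_mul] at this
  have hrq : plucker r q ≠ 0 := by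
    intro h
    obtain ⟨c, hc⟩ := exists_smul_of_plucker_eq_zero hq0 h
    have hsub : (lineSubst r q F).roots.toFinset ⊆ {-c} := by
      intro t ht
      rw [Multiset.mem_toFinset] at ht
      have ht' := Polynomial.isRoot_of_mem_roots ht
      rw [Polynomial.IsRoot.def, eval_lineSubst, hc, ← add_smul,
        eval_smul_of_isHomogeneous hhom, mul_eq_zero] at ht'
      have := pow_eq_zero_iff he |>.1 (ht'.resolve_right hq)
      rw [Finset.mem_singleton]
      linear_combination this
    have := Finset.card_le_card hsub
    rw [hcard, Finset.card_singleton] at this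
    omega
  have h := (hdeg.1 (plucker r q) ⟨hrq, plQuad_plucker r q⟩ fun hsub => hq ?_).2
  · rwa [ncard_inter_lineOfRep hhom hS hrq hq, hcard] at h
  · rw [← hS q hq0]
    apply hsub
    rw [mk_mem_lineOfRep, wedgePt_plucker_eq_zero_iff hrq]
    exact ⟨0, 1, by simp⟩

/-! ### Position of the two directrices -/

lemma exists_linearEquiv_single {v : Fin 4 → Fin 4 → K} (hv : LinearIndependent K v) :
    ∃ A : (Fin 4 → K) ≃ₗ[K] (Fin 4 → K), ∀ i, A (v i) = Pi.single i 1 := by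
  let b := basisOfLinearIndependentOfCardEqFinrank hv (by simp)
  refine ⟨b.equivFun, fun i => ?_⟩
  have h : v i = b i := by simp [b]
  ext j
  rw [h, Module.Basis.equivFun_self, Pi.single_apply]
  simp [eq_comm]

lemma exists_plucker_eq_of_mem {w : Fin 6 → K} {p : Fin 4 → K} (hw : w ≠ 0) (hq : plQuad w = 0)
    (hp : p ≠ 0) (h : wedgePt w p = 0) : ∃ b, w = plucker p b := by
  obtain ⟨u, v, rfl⟩ := exists_plucker_eq hq
  obtain ⟨a, b, rfl⟩ := exists_comb_of_wedgePt hw h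
  by_cases ha : a = 0
  · have hb : b ≠ 0 := by rintro rfl; simp [ha] at hp
    refine ⟨(-b⁻¹) • u + (0 : K) • v, ?_⟩
    rw [plucker_comb]
    simp [hb]
  · refine ⟨(0 : K) • u + a⁻¹ • v, ?_⟩
    rw [plucker_comb]
    simp [ha]

/-- If a linear map to `Fin k → K` has trivial kernel on `span X`, then `span X` has dimension at
most `k`. -/
lemma finrank_spanOfSet_le {n k : ℕ} {X : Set (PP K n)} (f : (Fin n → K) →ₗ[K] (Fin k → K))
    (U : Submodule K (Fin n → K))
    (hU : ∀ (v : Fin n → K) (hv : v ≠ 0), Projectivization.mk K v hv ∈ X → v ∈ U)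
    (hf : ∀ v ∈ U, f v = 0 → v = 0) : Module.finrank K (spanOfSet X) ≤ k := by
  have hle : spanOfSet X ≤ U := Submodule.span_le.2 fun v ⟨hv, h⟩ => hU v hv h
  have hinj : Function.Injective (f.domRestrict (spanOfSet X)) := by
    rw [← LinearMap.ker_eq_bot, LinearMap.ker_eq_bot']
    rintro ⟨v, hv⟩ h
    exact Subtype.ext (hf v (hle hv) h)
  simpa using LinearMap.finrank_le_finrank_of_injective hinj

/-- If all lines of an irreducible curve `X` spanning a `3`-space meet two distinct lines, then
these two lines are disjoint. -/
lemma lineOf_inter_lineOf_eq_empty {X : Set (PP K 6)} (hirr : ZIrred X) (hgr : X ⊆ grass K)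
    (hspan : Module.finrank K (spanOfSet X) = 4) {w₁ w₂ : Fin 6 → K} (h₁ : w₁ ≠ 0) (h₂ : w₂ ≠ 0)
    (q₁ : plQuad w₁ = 0) (q₂ : plQuad w₂ = 0)
    (hne : Projectivization.mk K w₁ h₁ ≠ Projectivization.mk K w₂ h₂)
    (hX : ∀ (z : Fin 6 → K) (hz : z ≠ 0), Projectivization.mk K z hz ∈ X →
      plPair w₁ z = 0 ∧ plPair w₂ z = 0) :
    lineOf (Projectivization.mk K w₁ h₁) ∩ lineOf (Projectivization.mk K w₂ h₂) = ∅ := by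
  by_contra hcon
  obtain ⟨x, hx₁, hx₂⟩ := Set.nonempty_iff_ne_empty.2 hcon
  induction x using Projectivization.ind with | h p hp => ?_
  rw [mk_mem_lineOf] at hx₁ hx₂
  obtain ⟨b, rfl⟩ := exists_plucker_eq_of_mem h₁ q₁ hp hx₁
  obtain ⟨c, rfl⟩ := exists_plucker_eq_of_mem h₂ q₂ hp hx₂
  have hli : LinearIndependent K ![p, b, c] := by
    rw [Fintype.linearIndependent_iff]
    intro g hg
    simp only [Fin.sum_univ_three, Matrix.cons_val] at hg
    have h0 : g 1 • plucker p b + g 2 • plucker p c = 0 := by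
      have : plucker p (g 0 • p + g 1 • b + g 2 • c) = g 1 • plucker p b + g 2 • plucker p c := by
        ext i; fin_cases i <;> simp [plucker] <;> ring
      rw [← this, hg]
      ext i; fin_cases i <;> simp [plucker]
    have hg1 : g 1 = 0 := by
      by_contra h
      apply hne
      rw [Projectivization.mk_eq_mk_iff']
      refine ⟨-(g 1)⁻¹ * g 2, ?_⟩
      have h' := congrArg (fun z => (g 1)⁻¹ • z) h0
      simp only [smul_add, smul_smul, inv_mul_cancel₀ h, one_smul, smul_zero] at h'
      rw [neg_mul, neg_smul, neg_eq_iff_add_eq_zero, add_comm]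
      exact h'
    have hg2 : g 2 = 0 := by
      rw [hg1, zero_smul, zero_add] at h0
      exact (smul_eq_zero.1 h0).resolve_right h₂
    have hg0 : g 0 = 0 := by
      rw [hg1, hg2, zero_smul, zero_smul, add_zero, add_zero] at hg
      exact (smul_eq_zero.1 hg).resolve_right hp
    intro i; fin_cases i <;> assumption
  obtain ⟨y, hy⟩ := exists_linearIndependent_cons_of_lt_finrank hli (by simp)
  obtain ⟨A, hA⟩ := exists_linearEquiv_single hy
  have e₁ : ext2Equiv A (plucker p b) = plucker (Pi.single 1 1) (Pi.single 2 1) := by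
    rw [ext2Equiv_plucker, ← hA 1, ← hA 2]; rfl
  have e₂ : ext2Equiv A (plucker p c) = plucker (Pi.single 1 1) (Pi.single 3 1) := by
    rw [ext2Equiv_plucker, ← hA 1, ← hA 3]; rfl
  have hz : ∀ (z : Fin 6 → K) (hz : z ≠ 0), Projectivization.mk K z hz ∈ X →
      ext2Equiv A z 1 = 0 ∧ ext2Equiv A z 2 = 0 ∧
        (ext2Equiv A z 0 = 0 ∨ ext2Equiv A z 5 = 0) := by
    intro z hz hzX
    have hzq := (mk_mem_grass hz).1 (hgr hzX)
    obtain ⟨p1, p2⟩ := hX z hz hzX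
    rw [← plPair_ext2Equiv A q₁ hzq, e₁] at p1
    rw [← plPair_ext2Equiv A q₂ hzq, e₂] at p2
    have hq := (plQuad_ext2Equiv A z).2 hzq
    have g1 : ext2Equiv A z 1 = 0 := by simpa [plPair, plucker] using p2
    have g2 : ext2Equiv A z 2 = 0 := by simpa [plPair, plucker] using p1
    refine ⟨g1, g2, ?_⟩
    rw [plQuad, g1, g2] at hq
    simpa using hq
  have hsub := hirr.2 _ _
    (zClosed_hyp fun j => (ext2Equiv A : (Fin 6 → K) →ₗ[K] (Fin 6 → K)) (Pi.single j 1) 0)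
    (zClosed_hyp fun j => (ext2Equiv A : (Fin 6 → K) →ₗ[K] (Fin 6 → K)) (Pi.single j 1) 5)
    (fun x hx => by
      induction x using Projectivization.ind with | h z hz0 => ?_
      rw [Set.mem_union, mk_mem_hyp, mk_mem_hyp, ← linearMap_apply_eq_sum,
        ← linearMap_apply_eq_sum]
      exact (hz z hz0 hx).2.2)
  have bound : ∀ k : Fin 6, (k = 0 ∨ k = 5) →
      (∀ (z : Fin 6 → K) (hz : z ≠ 0), Projectivization.mk K z hz ∈ X → ext2Equiv A z k = 0) →
      False := by
    intro k hk hkz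
    let π (i : Fin 6) : (Fin 6 → K) →ₗ[K] K :=
      LinearMap.proj i ∘ₗ (ext2Equiv A : (Fin 6 → K) →ₗ[K] (Fin 6 → K))
    have := finrank_spanOfSet_le (X := X) (LinearMap.pi ![π (5 - k), π 3, π 4])
      (LinearMap.ker (π 1) ⊓ LinearMap.ker (π 2) ⊓ LinearMap.ker (π k))
      (fun z hz0 hzX => ⟨⟨(hz z hz0 hzX).1, (hz z hz0 hzX).2.1⟩, hkz z hz0 hzX⟩) ?_
    · rw [hspan] at this
      omega
    · rintro z ⟨⟨z1, z2⟩, z3⟩ hzero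
      have t0 := congrFun hzero 0
      have t1 := congrFun hzero 1
      have t2 := congrFun hzero 2
      apply (ext2Equiv A).map_eq_zero_iff.1
      ext i
      rcases hk with rfl | rfl <;> fin_cases i <;> assumption
  rcases hsub with h | h
  · refine bound 0 (Or.inl rfl) fun z hz0 hzX => ?_
    have := h hzX
    rwa [mk_mem_hyp, ← linearMap_apply_eq_sum] at this
  · refine bound 5 (Or.inr rfl) fun z hz0 hzX => ?_
    have := h hzX
    rwa [mk_mem_hyp, ← linearMap_apply_eq_sum] at this

/-- Two disjoint lines can be moved to the two standard coordinate lines. -/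
lemma exists_linearEquiv_of_disjoint {w₁ w₂ : Fin 6 → K} (h₁ : w₁ ≠ 0) (h₂ : w₂ ≠ 0)
    (q₁ : plQuad w₁ = 0) (q₂ : plQuad w₂ = 0)
    (hdis : lineOf (Projectivization.mk K w₁ h₁) ∩ lineOf (Projectivization.mk K w₂ h₂) = ∅) :
    ∃ A : (Fin 4 → K) ≃ₗ[K] (Fin 4 → K), ext2Equiv A w₁ = ![0, 0, 0, 0, 0, 1] ∧
      ext2Equiv A w₂ = ![1, 0, 0, 0, 0, 0] := by
  obtain ⟨a, b, rfl⟩ := exists_plucker_eq q₁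
  obtain ⟨c, e, rfl⟩ := exists_plucker_eq q₂
  have hli : LinearIndependent K ![c, e, a, b] := by
    rw [Fintype.linearIndependent_iff]
    intro g hg
    simp only [Fin.sum_univ_four, Matrix.cons_val] at hg
    have hy : g 0 • c + g 1 • e = (-g 2) • a + (-g 3) • b := by
      rw [neg_smul, neg_smul]
      linear_combination hg
    have hy0 : g 0 • c + g 1 • e = 0 := by
      by_contra hne
      have : Projectivization.mk K _ hne ∈ lineOf (Projectivization.mk K _ h₁) ∩
          lineOf (Projectivization.mk K _ h₂) := by
        refine ⟨?_, ?_⟩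
        · rw [mk_mem_lineOf, hy, wedgePt_plucker_comb]
        · rw [mk_mem_lineOf, wedgePt_plucker_comb]
      rw [hdis] at this
      exact this
    have k1 := comb_eq_zero h₂ hy0
    have k2 := comb_eq_zero h₁ (hy.symm.trans hy0)
    rw [neg_eq_zero, neg_eq_zero] at k2
    intro i
    fin_cases i
    exacts [k1.1, k1.2, k2.1, k2.2]
  obtain ⟨A, hA⟩ := exists_linearEquiv_single hli
  have a0 : A c = Pi.single 0 1 := hA 0
  have a1 : A e = Pi.single 1 1 := hA 1
  have a2 : A a = Pi.single 2 1 := hA 2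
  have a3 : A b = Pi.single 3 1 := hA 3
  refine ⟨A, ?_, ?_⟩
  · rw [ext2Equiv_plucker, a2, a3]
    ext i; fin_cases i <;> simp [plucker]
  · rw [ext2Equiv_plucker, a0, a1]
    ext i; fin_cases i <;> simp [plucker]

/-! ### Bihomogeneous equations -/

lemma eval_aeval_eq {σ τ : Type*} (f : σ → MvPolynomial τ K) (p : MvPolynomial σ K) (y : τ → K) :
    eval y (aeval f p) = eval (fun i => eval y (f i)) p := by
  have h : (eval y).comp (aeval f : MvPolynomial σ K →ₐ[K] MvPolynomial τ K).toRingHom =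
      eval (fun i => eval y (f i)) := by
    refine MvPolynomial.ringHom_ext (fun r => ?_) fun i => ?_
    · simp [← algebraMap_eq]
    · simp
  exact RingHom.congr_fun h p

lemma eval_scale_fst {p : MvPolynomial (Fin 4) K} {m : ℕ}
    (hp : IsWeightedHomogeneous ![1, 1, 0, 0] p m) (c : K) (y : Fin 4 → K) :
    eval ![c * y 0, c * y 1, y 2, y 3] p = c ^ m * eval y p := by
  rw [← eval_weighted_smul hp c y]
  congr 2
  ext i; fin_cases i <;> simp

lemma eval_scale_snd {p : MvPolynomial (Fin 4) K} {m : ℕ}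
    (hp : IsWeightedHomogeneous ![0, 0, 1, 1] p m) (c : K) (y : Fin 4 → K) :
    eval ![y 0, y 1, c * y 2, c * y 3] p = c ^ m * eval y p := by
  rw [← eval_weighted_smul hp c y]
  congr 2
  ext i; fin_cases i <;> simp

lemma eval_scale {p : MvPolynomial (Fin 4) K} {m k : ℕ}
    (hp : IsWeightedHomogeneous ![1, 1, 0, 0] p m) (hp' : IsWeightedHomogeneous ![0, 0, 1, 1] p k)
    (b c : K) (y : Fin 4 → K) :
    eval ![b * y 0, b * y 1, c * y 2, c * y 3] p = b ^ m * (c ^ k * eval y p) := by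
  rw [← eval_scale_snd hp', ← eval_scale_fst hp]
  simp

/-- Substitutions which agree modulo `q` give results which agree modulo `q`. -/
lemma dvd_aeval_sub_aeval {σ τ : Type*} {q : MvPolynomial τ K} {f g : σ → MvPolynomial τ K}
    (h : ∀ i, q ∣ f i - g i) (p : MvPolynomial σ K) : q ∣ aeval f p - aeval g p := by
  have e : (Ideal.Quotient.mkₐ K (Ideal.span {q})).comp (aeval f) =
      (Ideal.Quotient.mkₐ K (Ideal.span {q})).comp (aeval g) := by
    refine MvPolynomial.algHom_ext fun i => ?_
    simp only [AlgHom.comp_apply, aeval_X, Ideal.Quotient.mkₐ_eq_mk]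
    rw [Ideal.Quotient.eq, Ideal.mem_span_singleton]
    exact h i
  rw [← Ideal.mem_span_singleton, ← Ideal.Quotient.eq]
  exact AlgHom.congr_fun e p

/-- A prime form of degree at least three, homogeneous in the last two variables, does not vanish
on the graph of a nonzero affine linear function of the first two variables. -/
lemma graph_eq_zero [Infinite K] {F : MvPolynomial (Fin 4) K} {d a₂ : ℕ} (hF : Prime F)
    (hhom : F.IsHomogeneous d) (hd : 3 ≤ d) (h₂ : IsWeightedHomogeneous ![0, 0, 1, 1] F a₂)
    (a b c : Fin 2 → K)
    (h : ∀ s t, eval ![s, t, a 0 + b 0 * s + c 0 * t, a 1 + b 1 * s + c 1 * t] F = 0) :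
    ∀ s t i, a i + b i * s + c i * t = 0 := by
  by_contra hcon
  push Not at hcon
  obtain ⟨s, t, i, hi⟩ := hcon
  let ℓ : Fin 2 → MvPolynomial (Fin 4) K := fun i => C (a i) + C (b i) * X 0 + C (c i) * X 1
  have hℓ : ∀ i y, eval y (ℓ i) = a i + b i * y 0 + c i * y 1 := fun i y => by simp [ℓ]
  have hℓdeg : ∀ i, (ℓ i).totalDegree ≤ 1 := fun i => by
    refine (totalDegree_add _ _).trans (max_le ((totalDegree_add _ _).trans (max_le ?_ ?_)) ?_)
    · simp
    · exact (totalDegree_mul _ _).trans (by simp [totalDegree_X])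
    · exact (totalDegree_mul _ _).trans (by simp [totalDegree_X])
  let q : MvPolynomial (Fin 4) K := ℓ 0 * X 3 - ℓ 1 * X 2
  have hq0 : q ≠ 0 := by
    intro h0
    fin_cases i
    · have := congrArg (eval ![s, t, 0, 1]) h0
      simp [q, hℓ] at this
      exact hi this
    · have := congrArg (eval ![s, t, 1, 0]) h0
      simp [q, hℓ] at this
      apply hi
      simp only [Fin.mk_one]
      linear_combination -this
  have hqdeg : q.totalDegree ≤ 2 := by
    refine (totalDegree_sub _ _).trans (max_le ?_ ?_)
    · exact (totalDegree_mul _ _).trans (by have := hℓdeg 0; rw [totalDegree_X]; omega)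
    · exact (totalDegree_mul _ _).trans (by have := hℓdeg 1; rw [totalDegree_X]; omega)
  have hFq : ¬ F ∣ q := by
    rintro ⟨r, hr⟩
    have hr0 : r ≠ 0 := by rintro rfl; simp [hr] at hq0
    have := totalDegree_mul_of_isDomain hF.ne_zero hr0
    rw [← hr, hhom.totalDegree hF.ne_zero] at this
    omega
  have hdvd : ∀ j, q ∣ ℓ j ^ a₂ * F := by
    intro j
    let k : Fin 4 := ![2, 3] j
    have e1 : ℓ j ^ a₂ * F = aeval ![X 0, X 1, ℓ j * X 2, ℓ j * X 3] F := by
      refine MvPolynomial.funext fun y => ?_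
      rw [eval_aeval_eq, map_mul, map_pow, ← eval_scale_snd h₂]
      congr 2
      ext i; fin_cases i <;> simp
    have e2 : (aeval ![X 0, X 1, ℓ 0 * X k, ℓ 1 * X k] F : MvPolynomial (Fin 4) K) = 0 := by
      refine MvPolynomial.funext fun y => ?_
      have := eval_scale_snd h₂ (y k) ![y 0, y 1, eval y (ℓ 0), eval y (ℓ 1)]
      rw [hℓ, hℓ, h, mul_zero] at this
      rw [eval_aeval_eq, map_zero, ← this]
      congr 2
      ext i; fin_cases i <;> simp [hℓ, mul_comm]
    have := dvd_aeval_sub_aeval (q := q) (f := ![X 0, X 1, ℓ j * X 2, ℓ j * X 3])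
      (g := ![X 0, X 1, ℓ 0 * X k, ℓ 1 * X k]) ?_ F
    · rwa [e2, sub_zero, ← e1] at this
    · intro i
      fin_cases j <;> fin_cases i <;> simp [k, q]
      rw [← dvd_neg, neg_sub]
  obtain ⟨r, hr⟩ := hdvd i
  rcases hF.dvd_or_dvd (⟨_, by rw [← hr, mul_comm]⟩ : F ∣ q * r) with h' | ⟨r', rfl⟩
  · exact hFq h'
  · have e : ℓ i ^ a₂ = q * r' := mul_right_cancel₀ hF.ne_zero (by rw [hr]; ring)
    have := congrArg (eval ![s, t, 0, 0]) e
    rw [map_pow, hℓ, map_mul] at this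
    have hq : eval ![s, t, 0, 0] q = 0 := by simp [q]
    rw [hq, zero_mul] at this
    exact pow_ne_zero _ hi this

/-- The coordinate permutation exchanging the two pairs of variables. -/
def pairSwap : Equiv.Perm (Fin 4) where
  toFun := ![2, 3, 0, 1]
  invFun := ![2, 3, 0, 1]
  left_inv i := by fin_cases i <;> rfl
  right_inv i := by fin_cases i <;> rfl

/-- The version of `graph_eq_zero` for functions of the last two variables. -/
lemma graph_eq_zero' [Infinite K] {F : MvPolynomial (Fin 4) K} {d a₁ : ℕ} (hF : Prime F)
    (hhom : F.IsHomogeneous d) (hd : 3 ≤ d) (h₁ : IsWeightedHomogeneous ![1, 1, 0, 0] F a₁)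
    (a b c : Fin 2 → K)
    (h : ∀ s t, eval ![a 0 + b 0 * s + c 0 * t, a 1 + b 1 * s + c 1 * t, s, t] F = 0) :
    ∀ s t i, a i + b i * s + c i * t = 0 := by
  refine graph_eq_zero (F := renameEquiv K pairSwap F) (a₂ := a₁)
    ((MulEquiv.prime_iff (renameEquiv K pairSwap)).2 hF)
    ((IsHomogeneous.rename_isHomogeneous_iff pairSwap.injective).2 hhom) hd ?_ a b c fun s t => ?_
  · intro m hm
    obtain ⟨u, rfl, hu⟩ := coeff_rename_ne_zero _ _ _ hm
    rw [← h₁ hu, Finsupp.weight_apply, Finsupp.weight_apply,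
      Finsupp.sum_fintype _ _ (by simp), Finsupp.sum_fintype _ _ (by simp),
      ← Equiv.sum_comp pairSwap]
    refine Finset.sum_congr rfl fun i _ => ?_
    rw [Finsupp.mapDomain_apply pairSwap.injective]
    fin_cases i <;> rfl
  · rw [renameEquiv_apply, eval_rename, ← h s t]
    congr 2
    ext i; fin_cases i <;> rfl

/-! ### Surfaces whose lines meet the two standard lines -/

/-- The Plücker vector of the line joining `(y₀ : y₁ : 0 : 0)` and `(0 : 0 : y₂ : y₃)`. -/
def segre (y : Fin 4 → K) : Fin 6 → K := ![0, y 0 * y 2, y 0 * y 3, y 1 * y 2, y 1 * y 3, 0]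

lemma segre_ne_zero_iff {y : Fin 4 → K} :
    segre y ≠ 0 ↔ ¬ (y 0 = 0 ∧ y 1 = 0) ∧ ¬ (y 2 = 0 ∧ y 3 = 0) := by
  constructor
  · intro h
    constructor <;> rintro ⟨h0, h1⟩ <;> apply h <;> ext i <;> fin_cases i <;> simp [segre, h0, h1]
  · rintro ⟨h1, h2⟩ h
    have e1 : y 0 * y 2 = 0 := congrFun h 1
    have e2 : y 0 * y 3 = 0 := congrFun h 2
    have e3 : y 1 * y 2 = 0 := congrFun h 3
    have e4 : y 1 * y 3 = 0 := congrFun h 4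
    simp only [mul_eq_zero] at e1 e2 e3 e4
    tauto

lemma ne_zero_of_segre_ne_zero {y : Fin 4 → K} (h : segre y ≠ 0) : y ≠ 0 := by
  rintro rfl
  exact (segre_ne_zero_iff.1 h).1 ⟨rfl, rfl⟩

lemma exists_segre_eq {z : Fin 6 → K} (h0 : z 0 = 0) (h5 : z 5 = 0) (hq : plQuad z = 0) :
    ∃ y, z = segre y := by
  have hq' : z 2 * z 3 = z 1 * z 4 := by
    rw [plQuad, h0] at hq; linear_combination hq
  by_cases h1 : z 1 = 0
  · by_cases h2 : z 2 = 0
    · exact ⟨![0, 1, z 3, z 4], by ext i; fin_cases i <;> simp [segre, *]⟩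
    · refine ⟨![z 2, z 4, z 1 / z 2, 1], ?_⟩
      have : z 3 = 0 := by simpa [h1, h2] using hq'
      ext i; fin_cases i <;> simp [segre, *]
  · refine ⟨![z 1, z 3, 1, z 2 / z 1], ?_⟩
    ext i; fin_cases i <;> simp [segre, h0, h5] <;> field_simp
    linear_combination -hq'

lemma wedgePt_segre_eq_zero_iff {y : Fin 4 → K} (hy : segre y ≠ 0) (x : Fin 4 → K) :
    wedgePt (segre y) x = 0 ↔
      ∃ b c, x = ![b * y 0, b * y 1, c * y 2, c * y 3] := by
  have e : segre y = plucker ![y 0, y 1, 0, 0] ![0, 0, y 2, y 3] := by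
    ext i; fin_cases i <;> simp [segre, plucker]
  rw [e] at hy ⊢
  rw [wedgePt_plucker_eq_zero_iff hy]
  refine exists_congr fun b => exists_congr fun c => ?_
  constructor <;> rintro rfl <;> ext i <;> fin_cases i <;> simp

lemma segre_scale (b c : K) (y : Fin 4 → K) :
    segre ![b * y 0, b * y 1, c * y 2, c * y 3] = (b * c) • segre y := by
  ext i; fin_cases i <;> simp [segre] <;> ring

lemma eval_eq_zero_of_fst {p : MvPolynomial (Fin 4) K} {m : ℕ}
    (hp : IsWeightedHomogeneous ![1, 1, 0, 0] p m) (hm : m ≠ 0) {y : Fin 4 → K} (h0 : y 0 = 0)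
    (h1 : y 1 = 0) : eval y p = 0 := by
  have := eval_scale_fst hp 0 y
  rw [zero_pow hm, zero_mul (eval y p)] at this
  rw [← this]
  congr 2
  ext i; fin_cases i <;> simp [h0, h1]

lemma eval_eq_zero_of_snd {p : MvPolynomial (Fin 4) K} {m : ℕ}
    (hp : IsWeightedHomogeneous ![0, 0, 1, 1] p m) (hm : m ≠ 0) {y : Fin 4 → K} (h0 : y 2 = 0)
    (h1 : y 3 = 0) : eval y p = 0 := by
  have := eval_scale_snd hp 0 y
  rw [zero_pow hm, zero_mul (eval y p)] at this
  rw [← this]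
  congr 2
  ext i; fin_cases i <;> simp [h0, h1]

/-- `S` is a surface with prime equation `F`, bihomogeneous of bidegree `(a₁, a₂)` and of degree
`d ≥ 3`, swept out by the lines joining `(y₀ : y₁ : 0 : 0)` and `(0 : 0 : y₂ : y₃)` for all `y`
with `F y = 0`; these lines form the curve `X`. -/
structure IsBihomSurface (S : Set (PP K 4)) (X : Set (PP K 6)) (F : MvPolynomial (Fin 4) K)
    (a₁ a₂ d : ℕ) : Prop where
  prime : Prime F
  homogeneous : F.IsHomogeneous d
  three_le : 3 ≤ d
  fst : IsWeightedHomogeneous ![1, 1, 0, 0] F a₁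
  snd : IsWeightedHomogeneous ![0, 0, 1, 1] F a₂
  mem_vanIdeal_iff : ∀ p, p ∈ vanIdeal S ↔ F ∣ p
  mk_mem : ∀ (v : Fin 4 → K) (hv : v ≠ 0), Projectivization.mk K v hv ∈ S ↔ eval v F = 0
  mk_mem_curve : ∀ (z : Fin 6 → K) (hz : z ≠ 0),
    Projectivization.mk K z hz ∈ X ↔ ∃ y, z = segre y ∧ eval y F = 0
  nonempty : X.Nonempty

namespace IsBihomSurface

variable {S : Set (PP K 4)} {X : Set (PP K 6)} {F : MvPolynomial (Fin 4) K} {a₁ a₂ d : ℕ}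

lemma exists_eval_ne_zero_fst [Infinite K] (h : IsBihomSurface S X F a₁ a₂ d)
    {y : Fin 4 → K} (hy : ¬ (y 2 = 0 ∧ y 3 = 0)) :
    ∃ s t, eval ![s, t, y 2, y 3] F ≠ 0 := by
  by_contra hcon
  push Not at hcon
  have := graph_eq_zero h.prime h.homogeneous h.three_le h.snd ![y 2, y 3] 0 0
    (fun s t => by simpa using hcon s t) 0 0
  exact hy ⟨by simpa using this 0, by simpa using this 1⟩

lemma exists_eval_ne_zero_snd [Infinite K] (h : IsBihomSurface S X F a₁ a₂ d)
    {y : Fin 4 → K} (hy : ¬ (y 0 = 0 ∧ y 1 = 0)) :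
    ∃ s t, eval ![y 0, y 1, s, t] F ≠ 0 := by
  by_contra hcon
  push Not at hcon
  have := graph_eq_zero' h.prime h.homogeneous h.three_le h.fst ![y 0, y 1] 0 0
    (fun s t => by simpa using hcon s t) 0 0
  exact hy ⟨by simpa using this 0, by simpa using this 1⟩

lemma exists_segre (h : IsBihomSurface S X F a₁ a₂ d) : ∃ y, segre y ≠ 0 ∧ eval y F = 0 := by
  obtain ⟨x, hx⟩ := h.nonempty
  induction x using Projectivization.ind with | h z hz => ?_
  obtain ⟨y, rfl, hy⟩ := (h.mk_mem_curve z hz).1 hx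
  exact ⟨y, hz, hy⟩

lemma one_le_fst [Infinite K] (h : IsBihomSurface S X F a₁ a₂ d) : 1 ≤ a₁ := by
  rw [Nat.one_le_iff_ne_zero]
  rintro rfl
  obtain ⟨y, hy, hF⟩ := h.exists_segre
  obtain ⟨s, t, hst⟩ := h.exists_eval_ne_zero_fst (segre_ne_zero_iff.1 hy).2
  have e1 := eval_scale_fst h.fst 0 y
  have e2 := eval_scale_fst h.fst 0 ![s, t, y 2, y 3]
  simp only [pow_zero, one_mul, zero_mul, Matrix.cons_val] at e1 e2
  exact hst (by rw [← e2, e1, hF])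

lemma one_le_snd [Infinite K] (h : IsBihomSurface S X F a₁ a₂ d) : 1 ≤ a₂ := by
  rw [Nat.one_le_iff_ne_zero]
  rintro rfl
  obtain ⟨y, hy, hF⟩ := h.exists_segre
  obtain ⟨s, t, hst⟩ := h.exists_eval_ne_zero_snd (segre_ne_zero_iff.1 hy).1
  have e1 := eval_scale_snd h.snd 0 y
  have e2 := eval_scale_snd h.snd 0 ![y 0, y 1, s, t]
  simp only [pow_zero, one_mul, zero_mul, Matrix.cons_val] at e1 e2
  exact hst (by rw [← e2, e1, hF])

lemma add_eq [Infinite K] (h : IsBihomSurface S X F a₁ a₂ d) : a₁ + a₂ = d := by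
  obtain ⟨m, hm⟩ := exists_coeff_ne_zero h.prime.ne_zero
  have e1 := h.fst hm
  have e2 := h.snd hm
  have e3 := h.homogeneous hm
  rw [Finsupp.weight_apply, Finsupp.sum_fintype _ _ (by simp), Fin.sum_univ_four] at e1 e2 e3
  simp at e1 e2 e3
  omega

lemma eval_eq_zero_fst [Infinite K] (h : IsBihomSurface S X F a₁ a₂ d) {y : Fin 4 → K}
    (h0 : y 0 = 0) (h1 : y 1 = 0) : eval y F = 0 :=
  eval_eq_zero_of_fst h.fst (by have := h.one_le_fst; omega) h0 h1

lemma eval_eq_zero_snd [Infinite K] (h : IsBihomSurface S X F a₁ a₂ d) {y : Fin 4 → K}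
    (h0 : y 2 = 0) (h1 : y 3 = 0) : eval y F = 0 :=
  eval_eq_zero_of_snd h.snd (by have := h.one_le_snd; omega) h0 h1

/-- A line on `S` missing the line `t₁ = t₂ = 0` is the line `t₃ = t₄ = 0`. -/
lemma eq_of_fst_ne_zero [Infinite K] (h : IsBihomSurface S X F a₁ a₂ d) {z : Fin 6 → K}
    (hq : plQuad z = 0) (hz : z 0 ≠ 0) (hS : lineOfRep z ⊆ S) :
    z = z 0 • ![1, 0, 0, 0, 0, 0] := by
  rw [plQuad] at hq
  have key := graph_eq_zero h.prime h.homogeneous h.three_le h.snd 0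
    ![-(z 3 / z 0), -(z 4 / z 0)] ![z 1 / z 0, z 2 / z 0] fun s t => by
      by_cases hst : s = 0 ∧ t = 0
      · exact h.eval_eq_zero_fst (by simp [hst.1]) (by simp [hst.2])
      · rw [← h.mk_mem _ (fun e => hst ⟨congrFun e 0, congrFun e 1⟩)]
        apply hS
        rw [mk_mem_lineOfRep]
        ext i
        fin_cases i <;> simp [wedgePt] <;> field_simp
        · ring
        · ring
        · linear_combination s * hq
        · linear_combination t * hq
  have k1 := key 1 0
  have k2 := key 0 1
  have g1 : z 3 = 0 := by simpa [hz] using k1 0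
  have g2 : z 4 = 0 := by simpa [hz] using k1 1
  have g3 : z 1 = 0 := by simpa [hz] using k2 0
  have g4 : z 2 = 0 := by simpa [hz] using k2 1
  have g5 : z 5 = 0 := by simpa [g1, g2, hz] using hq
  ext i; fin_cases i <;> simp [*]

/-- A line on `S` missing the line `t₃ = t₄ = 0` is the line `t₁ = t₂ = 0`. -/
lemma eq_of_last_ne_zero [Infinite K] (h : IsBihomSurface S X F a₁ a₂ d) {z : Fin 6 → K}
    (hq : plQuad z = 0) (hz : z 5 ≠ 0) (hS : lineOfRep z ⊆ S) :
    z = z 5 • ![0, 0, 0, 0, 0, 1] := by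
  rw [plQuad] at hq
  have key := graph_eq_zero' h.prime h.homogeneous h.three_le h.fst 0
    ![z 2 / z 5, z 4 / z 5] ![-(z 1 / z 5), -(z 3 / z 5)] fun s t => by
      by_cases hst : s = 0 ∧ t = 0
      · exact h.eval_eq_zero_snd (by simp [hst.1]) (by simp [hst.2])
      · rw [← h.mk_mem _ (fun e => hst ⟨congrFun e 2, congrFun e 3⟩)]
        apply hS
        rw [mk_mem_lineOfRep]
        ext i
        fin_cases i <;> simp [wedgePt] <;> field_simp
        · linear_combination s * hq
        · linear_combination t * hq
        · ring
        · ring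
  have k1 := key 1 0
  have k2 := key 0 1
  have g1 : z 2 = 0 := by simpa [hz] using k1 0
  have g2 : z 4 = 0 := by simpa [hz] using k1 1
  have g3 : z 1 = 0 := by simpa [hz] using k2 0
  have g4 : z 3 = 0 := by simpa [hz] using k2 1
  have g5 : z 0 = 0 := by simpa [g1, g2, hz] using hq
  ext i; fin_cases i <;> simp [*]

/-- The isolated lines of `S` are the two standard lines. -/
lemma linesOf_diff [Infinite K] (h : IsBihomSurface S X F a₁ a₂ d) {z : Fin 6 → K} (hz : z ≠ 0) :
    Projectivization.mk K z hz ∈ linesOf S \ X ↔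
      (∃ c : K, z = c • ![0, 0, 0, 0, 0, 1]) ∨ ∃ c : K, z = c • ![1, 0, 0, 0, 0, 0] := by
  have hX : ∀ (c : K) (y : Fin 4 → K), segre y = c • ![0, 0, 0, 0, 0, 1] ∨ segre y = c • ![1, 0, 0, 0, 0, 0] →
      c = 0 := by
    rintro c y (e | e)
    · simpa [segre] using (congrFun e 5).symm
    · simpa [segre] using (congrFun e 0).symm
  constructor
  · rintro ⟨⟨hg, hS⟩, hzX⟩
    rw [mk_mem_grass] at hg
    rw [lineOf_mk] at hS
    by_cases h0 : z 0 = 0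
    · by_cases h5 : z 5 = 0
      · obtain ⟨y, rfl⟩ := exists_segre_eq h0 h5 hg
        refine absurd ((h.mk_mem_curve _ hz).2 ⟨y, rfl, ?_⟩) hzX
        rw [← h.mk_mem y (ne_zero_of_segre_ne_zero hz)]
        apply hS
        rw [mk_mem_lineOfRep, wedgePt_segre_eq_zero_iff hz]
        exact ⟨1, 1, by ext i; fin_cases i <;> simp⟩
      · exact Or.inl ⟨_, h.eq_of_last_ne_zero hg h5 hS⟩
    · exact Or.inr ⟨_, h.eq_of_fst_ne_zero hg h0 hS⟩
  · intro hc
    refine ⟨⟨(mk_mem_grass hz).2 ?_, fun p hp => ?_⟩, fun hzX => ?_⟩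
    · rcases hc with ⟨c, rfl⟩ | ⟨c, rfl⟩ <;> simp [plQuad]
    · induction p using Projectivization.ind with | h y hy => ?_
      rw [mk_mem_lineOf] at hp
      rw [h.mk_mem]
      rcases hc with ⟨c, rfl⟩ | ⟨c, rfl⟩
      · have hc0 : c ≠ 0 := by rintro rfl; simp at hz
        refine h.eval_eq_zero_fst ?_ ?_
        · simpa [wedgePt, hc0] using congrFun hp 2
        · simpa [wedgePt, hc0] using congrFun hp 3
      · have hc0 : c ≠ 0 := by rintro rfl; simp at hz
        refine h.eval_eq_zero_snd ?_ ?_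
        · simpa [wedgePt, hc0] using congrFun hp 0
        · simpa [wedgePt, hc0] using congrFun hp 1
    · obtain ⟨y, rfl, -⟩ := (h.mk_mem_curve z hz).1 hzX
      rcases hc with ⟨c, e⟩ | ⟨c, e⟩
      · apply hz; rw [e, hX c y (Or.inl e), zero_smul]
      · apply hz; rw [e, hX c y (Or.inr e), zero_smul]

end IsBihomSurface

/-! ### Singular points -/

lemma mem_vanIdeal_of_mem_homIdeal {n : ℕ} {X : Set (PP K n)} {p : MvPolynomial (Fin n) K}
    (hp : p ∈ homIdeal X) : p ∈ vanIdeal X :=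
  fun v hv h => hp.2 _ h v hv rfl

lemma mem_homIdeal_of_mem_vanIdeal {n m : ℕ} {X : Set (PP K n)} {p : MvPolynomial (Fin n) K}
    (hp : p ∈ vanIdeal X) (hm : p.IsHomogeneous m) : p ∈ homIdeal X := by
  refine ⟨⟨m, hm⟩, fun x hx => ?_⟩
  rintro v hv rfl
  exact hp v hv hx

/-- The gradient of a polynomial. -/
noncomputable def grad {n : ℕ} (p : MvPolynomial (Fin n) K) (v : Fin n → K) : Fin n → K :=
  fun i => eval v (pderiv i p)

lemma grad_mul_of_eval_eq_zero {n : ℕ} {p : MvPolynomial (Fin n) K} {v : Fin n → K}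
    (hp : eval v p = 0) (q : MvPolynomial (Fin n) K) :
    grad (p * q) v = eval v q • grad p v := by
  ext i
  simp [grad, Derivation.leibniz, hp]

lemma finrank_span_singleton_eq_one_iff {n : ℕ} (v : Fin n → K) :
    Module.finrank K (Submodule.span K {v}) = 1 ↔ v ≠ 0 := by
  refine ⟨?_, finrank_span_singleton⟩
  rintro e rfl
  rw [Submodule.span_zero_singleton, finrank_bot] at e
  exact zero_ne_one e

namespace IsBihomSurface

variable {S : Set (PP K 4)} {X : Set (PP K 6)} {F : MvPolynomial (Fin 4) K} {a₁ a₂ d : ℕ}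

lemma surfSmoothPt_iff (h : IsBihomSurface S X F a₁ a₂ d) {y : Fin 4 → K} (hy : y ≠ 0)
    (hF : eval y F = 0) : SurfSmoothPt S (Projectivization.mk K y hy) ↔ grad F y ≠ 0 := by
  rw [surfSmoothPt_mk, ← finrank_span_singleton_eq_one_iff]
  have : gradSpan S y = Submodule.span K {grad F y} := by
    apply le_antisymm
    · refine Submodule.span_le.2 ?_
      rintro _ ⟨p, hp, rfl⟩
      obtain ⟨q, rfl⟩ := (h.mem_vanIdeal_iff p).1 (mem_vanIdeal_of_mem_homIdeal hp)
      exact Submodule.mem_span_singleton.2 ⟨_, (grad_mul_of_eval_eq_zero hF q).symm⟩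
    · refine (Submodule.span_singleton_le_iff_mem _ _).2 (Submodule.subset_span ⟨F, ?_, rfl⟩)
      exact mem_homIdeal_of_mem_vanIdeal ((h.mem_vanIdeal_iff F).2 dvd_rfl) h.homogeneous
  rw [this]

lemma mem_singLocus_iff (h : IsBihomSurface S X F a₁ a₂ d) {y : Fin 4 → K} (hy : y ≠ 0) :
    Projectivization.mk K y hy ∈ singLocus S ↔ eval y F = 0 ∧ grad F y = 0 := by
  simp only [singLocus, Set.mem_ofPred_eq, h.mk_mem]
  refine and_congr_right fun hF => ?_
  rw [h.surfSmoothPt_iff hy hF, not_not]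

/-- The partial derivatives of a bihomogeneous polynomial are bihomogeneous. -/
lemma exists_pderiv (h : IsBihomSurface S X F a₁ a₂ d) (h₁ : 1 ≤ a₁) (h₂ : 1 ≤ a₂) (i : Fin 4) :
    (∃ m, (2 ≤ a₁ → m ≠ 0) ∧ IsWeightedHomogeneous ![1, 1, 0, 0] (pderiv i F) m) ∧
    ∃ m, (2 ≤ a₂ → m ≠ 0) ∧ IsWeightedHomogeneous ![0, 0, 1, 1] (pderiv i F) m := by
  constructor
  · refine ⟨a₁ - ![1, 1, 0, 0] i, fun _ => ?_, h.fst.pderiv ?_⟩ <;> fin_cases i <;> simp <;> omega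
  · refine ⟨a₂ - ![0, 0, 1, 1] i, fun _ => ?_, h.snd.pderiv ?_⟩ <;> fin_cases i <;> simp <;> omega

lemma grad_scale [Infinite K] (h : IsBihomSurface S X F a₁ a₂ d) {y : Fin 4 → K}
    (hy : grad F y = 0) (b c : K) : grad F ![b * y 0, b * y 1, c * y 2, c * y 3] = 0 := by
  ext i
  obtain ⟨⟨m, -, hm⟩, ⟨k, -, hk⟩⟩ := h.exists_pderiv h.one_le_fst h.one_le_snd i
  have : eval y (pderiv i F) = 0 := congrFun hy i
  rw [grad, eval_scale hm hk, this, mul_zero, mul_zero]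
  rfl

lemma grad_eq_zero_fst_iff [Infinite K] (h : IsBihomSurface S X F a₁ a₂ d) {y : Fin 4 → K}
    (hy : y ≠ 0) (h0 : y 0 = 0) (h1 : y 1 = 0) : grad F y = 0 ↔ 1 < a₁ := by
  constructor
  · intro hg
    by_contra hcon
    have ha : a₁ = 1 := by have := h.one_le_fst; omega
    subst ha
    have hy2 : ¬ (y 2 = 0 ∧ y 3 = 0) := fun e => hy (by ext i; fin_cases i <;> simp [*])
    obtain ⟨s, t, hst⟩ := h.exists_eval_ne_zero_fst hy2
    have hi : ∀ i, ![1, 1, 0, 0] i = 1 → eval ![s, t, y 2, y 3] (pderiv i F) = 0 := by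
      intro i hi
      have hw : IsWeightedHomogeneous ![1, 1, 0, 0] (pderiv i F) 0 := h.fst.pderiv (by simp [hi])
      have e := eval_scale_fst hw 0 ![s, t, y 2, y 3]
      rw [pow_zero, one_mul] at e
      have e' : eval y (pderiv i F) = 0 := congrFun hg i
      rw [← e, ← e']
      congr 2
      ext j; fin_cases j <;> simp [*]
    have euler := congrArg (eval ![s, t, y 2, y 3]) h.fst.sum_weight_X_mul_pderiv
    simp [Fin.sum_univ_four, hi 0 rfl, hi 1 rfl] at euler
    exact hst euler.symm
  · intro ha
    ext i
    obtain ⟨⟨m, hm0, hm⟩, -⟩ := h.exists_pderiv h.one_le_fst h.one_le_snd i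
    exact eval_eq_zero_of_fst hm (hm0 ha) h0 h1

lemma grad_eq_zero_snd_iff [Infinite K] (h : IsBihomSurface S X F a₁ a₂ d) {y : Fin 4 → K}
    (hy : y ≠ 0) (h2 : y 2 = 0) (h3 : y 3 = 0) : grad F y = 0 ↔ 1 < a₂ := by
  constructor
  · intro hg
    by_contra hcon
    have ha : a₂ = 1 := by have := h.one_le_snd; omega
    subst ha
    have hy2 : ¬ (y 0 = 0 ∧ y 1 = 0) := fun e => hy (by ext i; fin_cases i <;> simp [*])
    obtain ⟨s, t, hst⟩ := h.exists_eval_ne_zero_snd hy2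
    have hi : ∀ i, ![0, 0, 1, 1] i = 1 → eval ![y 0, y 1, s, t] (pderiv i F) = 0 := by
      intro i hi
      have hw : IsWeightedHomogeneous ![0, 0, 1, 1] (pderiv i F) 0 := h.snd.pderiv (by simp [hi])
      have e := eval_scale_snd hw 0 ![y 0, y 1, s, t]
      rw [pow_zero, one_mul] at e
      have e' : eval y (pderiv i F) = 0 := congrFun hg i
      rw [← e, ← e']
      congr 2
      ext j; fin_cases j <;> simp [*]
    have euler := congrArg (eval ![y 0, y 1, s, t]) h.snd.sum_weight_X_mul_pderiv
    simp [Fin.sum_univ_four, hi 2 rfl, hi 3 rfl] at euler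
    exact hst euler.symm
  · intro ha
    ext i
    obtain ⟨-, m, hm0, hm⟩ := h.exists_pderiv h.one_le_fst h.one_le_snd i
    exact eval_eq_zero_of_snd hm (hm0 ha) h2 h3

end IsBihomSurface

/-- The polynomials defining `segre`. -/
noncomputable def segrePoly : Fin 6 → MvPolynomial (Fin 4) K :=
  ![0, X 0 * X 2, X 0 * X 3, X 1 * X 2, X 1 * X 3, 0]

lemma eval_aeval_segrePoly (p : MvPolynomial (Fin 6) K) (y : Fin 4 → K) :
    eval y (aeval segrePoly p) = eval (segre y) p := by
  rw [eval_aeval_eq]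
  congr 2
  ext i; fin_cases i <;> simp [segrePoly, segre]

/-- The transpose of the differential of `segre` at `y`. -/
def segreCodiff (y : Fin 4 → K) : (Fin 6 → K) →ₗ[K] (Fin 4 → K) where
  toFun g := ![g 1 * y 2 + g 2 * y 3, g 3 * y 2 + g 4 * y 3, g 1 * y 0 + g 3 * y 1,
    g 2 * y 0 + g 4 * y 1]
  map_add' g h := by ext i; fin_cases i <;> simp <;> ring
  map_smul' c g := by ext i; fin_cases i <;> simp <;> ring

lemma grad_aeval_segrePoly (p : MvPolynomial (Fin 6) K) (y : Fin 4 → K) :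
    grad (aeval segrePoly p) y = segreCodiff y (grad p (segre y)) := by
  ext i
  rw [grad, pderiv_aeval, map_sum, Fin.sum_univ_six]
  simp only [map_mul, eval_aeval_segrePoly]
  fin_cases i <;>
    simp [segrePoly, segreCodiff, grad, Derivation.leibniz, pderiv_X]

/-- A parametrization of the kernel of `segreCodiff`. -/
def conormal (y : Fin 4 → K) : (Fin 3 → K) →ₗ[K] (Fin 6 → K) where
  toFun t := ![t 0, t 2 * (y 1 * y 3), -(t 2 * (y 1 * y 2)), -(t 2 * (y 0 * y 3)),
    t 2 * (y 0 * y 2), t 1]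
  map_add' g h := by ext i; fin_cases i <;> simp <;> ring
  map_smul' c g := by ext i; fin_cases i <;> simp <;> ring

lemma exists_perp {a b p q : K} (h : ¬ (p = 0 ∧ q = 0)) (e : a * p + b * q = 0) :
    ∃ s, a = -(s * q) ∧ b = s * p := by
  by_cases hp : p = 0
  · have hq : q ≠ 0 := fun hq => h ⟨hp, hq⟩
    refine ⟨-(a / q), by field_simp, ?_⟩
    have : b * q = 0 := by simpa [hp] using e
    simpa [hp, hq] using this
  · refine ⟨b / p, ?_, by field_simp⟩
    field_simp
    linear_combination e

lemma exists_form_apply_ne_zero {p q : K} (h : ¬ (p = 0 ∧ q = 0)) :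
    ∃ a b : K, a * p + b * q ≠ 0 := by
  by_cases hp : p = 0
  · exact ⟨0, 1, by simpa using fun hq => h ⟨hp, hq⟩⟩
  · exact ⟨1, 0, by simpa using hp⟩

lemma ker_segreCodiff {y : Fin 4 → K} (hy : segre y ≠ 0) :
    LinearMap.ker (segreCodiff y) = LinearMap.range (conormal y) := by
  obtain ⟨hu, hv⟩ := segre_ne_zero_iff.1 hy
  apply le_antisymm
  · intro g hg
    have hg : segreCodiff y g = 0 := hg
    have e0 : g 1 * y 2 + g 2 * y 3 = 0 := congrFun hg 0
    have e1 : g 3 * y 2 + g 4 * y 3 = 0 := congrFun hg 1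
    have e2 : g 1 * y 0 + g 3 * y 1 = 0 := congrFun hg 2
    have e3 : g 2 * y 0 + g 4 * y 1 = 0 := congrFun hg 3
    obtain ⟨s, s1, s2⟩ := exists_perp hv e0
    obtain ⟨t, t1, t2⟩ := exists_perp hv e1
    have e : s * y 0 + t * y 1 = 0 := by
      by_contra hne
      refine hv ⟨?_, ?_⟩ <;> refine (mul_eq_zero.1 ?_).resolve_left hne
      · rw [s2, t2] at e3; linear_combination e3
      · rw [s1, t1] at e2; linear_combination -e2
    obtain ⟨r, r1, r2⟩ := exists_perp hu e
    refine ⟨![g 0, g 5, r], ?_⟩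
    ext i
    fin_cases i <;> simp [conormal, s1, s2, t1, t2, r1, r2] <;> ring
  · rintro _ ⟨t, rfl⟩
    change segreCodiff y (conormal y t) = 0
    ext i
    fin_cases i <;> simp [segreCodiff, conormal] <;> ring

lemma conormal_injective {y : Fin 4 → K} (hy : segre y ≠ 0) :
    Function.Injective (conormal y) := by
  obtain ⟨hu, hv⟩ := segre_ne_zero_iff.1 hy
  rw [← LinearMap.ker_eq_bot, LinearMap.ker_eq_bot']
  intro t ht
  have e0 : t 0 = 0 := congrFun ht 0
  have e1 : t 1 = 0 := congrFun ht 5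
  have e2 : t 2 = 0 := by
    by_contra hne
    apply hy
    have c1 := congrFun ht 1
    have c2 := congrFun ht 2
    have c3 := congrFun ht 3
    have c4 := congrFun ht 4
    simp [conormal, hne] at c1 c2 c3 c4
    ext i; fin_cases i <;> simp [segre] <;> tauto
  ext i; fin_cases i <;> assumption

lemma finrank_ker_segreCodiff {y : Fin 4 → K} (hy : segre y ≠ 0) :
    Module.finrank K (LinearMap.ker (segreCodiff y)) = 3 := by
  rw [ker_segreCodiff hy, LinearMap.finrank_range_of_inj (conormal_injective hy)]
  simp

lemma finrank_eq_map_add_ker {n m : ℕ} (f : (Fin n → K) →ₗ[K] (Fin m → K))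
    {G : Submodule K (Fin n → K)} (hG : LinearMap.ker f ≤ G) :
    Module.finrank K G = Module.finrank K (G.map f) + Module.finrank K (LinearMap.ker f) := by
  have h := LinearMap.finrank_range_add_finrank_ker (f.domRestrict G)
  rw [LinearMap.range_domRestrict, LinearMap.ker_domRestrict] at h
  rw [← h, (Submodule.comapSubtypeEquivOfLe hG).finrank_eq]

namespace IsBihomSurface

variable {S : Set (PP K 4)} {T : Set (PP K 6)} {F : MvPolynomial (Fin 4) K} {a₁ a₂ d : ℕ}

lemma dvd_aeval_segrePoly (h : IsBihomSurface S T F a₁ a₂ d) {p : MvPolynomial (Fin 6) K}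
    (hp : p ∈ homIdeal T) : F ∣ aeval segrePoly p := by
  rw [← h.mem_vanIdeal_iff]
  intro y hy hyS
  rw [eval_aeval_segrePoly]
  by_cases hs : segre y = 0
  · obtain ⟨⟨m, hm⟩, -⟩ := id hp
    obtain ⟨x, hx⟩ := h.nonempty
    induction x using Projectivization.ind with | h z hz => ?_
    have e := eval_smul_of_isHomogeneous hm 0 z
    rwa [mem_vanIdeal_of_mem_homIdeal hp z hz hx, mul_zero, zero_smul, ← hs] at e
  · exact mem_vanIdeal_of_mem_homIdeal hp _ hs
      ((h.mk_mem_curve _ hs).2 ⟨y, rfl, (h.mk_mem y hy).1 hyS⟩)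

lemma ker_segreCodiff_le (h : IsBihomSurface S T F a₁ a₂ d) {y : Fin 4 → K} (hy : segre y ≠ 0) :
    LinearMap.ker (segreCodiff y) ≤ gradSpan T (segre y) := by
  have hX : ∀ {p : MvPolynomial (Fin 6) K} {m : ℕ}, p.IsHomogeneous m →
      (∀ y, eval (segre y) p = 0) → grad p (segre y) ∈ gradSpan T (segre y) := by
    intro p m hm hp
    refine Submodule.subset_span ⟨p, mem_homIdeal_of_mem_vanIdeal (fun z hz hzX => ?_) hm, rfl⟩
    obtain ⟨x, rfl, -⟩ := (h.mk_mem_curve z hz).1 hzX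
    exact hp x
  have h0 := hX (isHomogeneous_X K 0) (by simp [segre])
  have h5 := hX (isHomogeneous_X K 5) (by simp [segre])
  have hq := hX (p := X 1 * X 4 - X 2 * X 3)
    (((isHomogeneous_X K 1).mul (isHomogeneous_X K 4)).sub
      ((isHomogeneous_X K 2).mul (isHomogeneous_X K 3))) (fun y => by simp [segre]; ring)
  rw [ker_segreCodiff hy]
  rintro _ ⟨t, rfl⟩
  have : conormal y t = t 0 • grad (X 0) (segre y) + t 1 • grad (X 5) (segre y) +
      t 2 • grad (X 1 * X 4 - X 2 * X 3) (segre y) := by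
    ext i
    fin_cases i <;>
      simp [conormal, grad, segre, Derivation.leibniz, pderiv_X]
  rw [this]
  exact add_mem (add_mem (Submodule.smul_mem _ _ h0) (Submodule.smul_mem _ _ h5))
    (Submodule.smul_mem _ _ hq)

lemma grad_mem_map_gradSpan [Infinite K] (h : IsBihomSurface S T F a₁ a₂ d) {y : Fin 4 → K}
    (hy : segre y ≠ 0) (hF : eval y F = 0) :
    grad F y ∈ (gradSpan T (segre y)).map (segreCodiff y) := by
  obtain ⟨hu, hv⟩ := segre_ne_zero_iff.1 hy
  obtain ⟨α, α', hα⟩ := exists_form_apply_ne_zero hu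
  obtain ⟨β, β', hβ⟩ := exists_form_apply_ne_zero hv
  let f : Fin 4 → MvPolynomial (Fin 6) K := ![C β * X 1 + C β' * X 2, C β * X 3 + C β' * X 4,
    C α * X 1 + C α' * X 3, C α * X 2 + C α' * X 4]
  let H : MvPolynomial (Fin 4) K :=
    (C β * X 2 + C β' * X 3) ^ a₁ * (C α * X 0 + C α' * X 1) ^ a₂
  have hpull : aeval segrePoly (aeval f F) = F * H := by
    refine MvPolynomial.funext fun x => ?_
    rw [eval_aeval_segrePoly, eval_aeval_eq]
    have := eval_scale h.fst h.snd (β * x 2 + β' * x 3) (α * x 0 + α' * x 1) x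
    rw [show eval x (F * H) = (β * x 2 + β' * x 3) ^ a₁ *
      ((α * x 0 + α' * x 1) ^ a₂ * eval x F) by simp [H]; ring, ← this]
    congr 2
    ext i; fin_cases i <;> simp [f, segre] <;> ring
  have hlin : ∀ (a b : K) (i j : Fin 6),
      (C a * X i + C b * X j : MvPolynomial (Fin 6) K).IsHomogeneous 1 :=
    fun a b i j => by
      simpa using ((isHomogeneous_C _ a).mul (isHomogeneous_X K i)).add
        ((isHomogeneous_C _ b).mul (isHomogeneous_X K j))
  have hhom : (aeval f F : MvPolynomial (Fin 6) K).IsHomogeneous (1 * d) :=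
    h.homogeneous.aeval f fun i => by fin_cases i <;> exact hlin _ _ _ _
  have hmem : aeval f F ∈ homIdeal T := by
    refine mem_homIdeal_of_mem_vanIdeal (fun z hz hzX => ?_) hhom
    obtain ⟨x, rfl, hx⟩ := (h.mk_mem_curve z hz).1 hzX
    rw [← eval_aeval_segrePoly, hpull, map_mul, hx, zero_mul]
  have hg := grad_aeval_segrePoly (aeval f F) y
  rw [hpull, grad_mul_of_eval_eq_zero hF] at hg
  have hH : eval y H ≠ 0 := by
    simpa [H] using ⟨fun e => absurd e hβ, fun e => absurd e hα⟩
  rw [← Submodule.smul_mem_iff _ hH, hg]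
  exact Submodule.mem_map_of_mem (Submodule.subset_span ⟨_, hmem, rfl⟩)

/-- A point of the curve is smooth if and only if the gradient of `F` does not vanish at the
corresponding point. -/
lemma curveSmoothPt_iff [Infinite K] (h : IsBihomSurface S T F a₁ a₂ d) {y : Fin 4 → K}
    (hy : segre y ≠ 0) (hF : eval y F = 0) :
    CurveSmoothPt T (Projectivization.mk K (segre y) hy) ↔ grad F y ≠ 0 := by
  have hmap : (gradSpan T (segre y)).map (segreCodiff y) = Submodule.span K {grad F y} := by
    apply le_antisymm
    · rw [Submodule.map_le_iff_le_comap]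
      refine Submodule.span_le.2 ?_
      rintro _ ⟨p, hp, rfl⟩
      obtain ⟨q, hq⟩ := h.dvd_aeval_segrePoly hp
      refine Submodule.mem_span_singleton.2 ⟨eval y q, ?_⟩
      rw [← grad_mul_of_eval_eq_zero hF, ← hq, grad_aeval_segrePoly]
      rfl
    · exact (Submodule.span_singleton_le_iff_mem _ _).2 (h.grad_mem_map_gradSpan hy hF)
  rw [curveSmoothPt_mk, finrank_eq_map_add_ker _ (h.ker_segreCodiff_le hy), hmap,
    finrank_ker_segreCodiff hy, ← finrank_span_singleton_eq_one_iff]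
  omega

/-- The singular locus of `S`. -/
lemma mem_singLocus_iff_or [Infinite K] (h : IsBihomSurface S T F a₁ a₂ d) {p : PP K 4} :
    p ∈ singLocus S ↔ (1 < a₁ ∧ p ∈ lineOfRep ![0, 0, 0, 0, 0, 1]) ∨
      (1 < a₂ ∧ p ∈ lineOfRep ![1, 0, 0, 0, 0, 0]) ∨
      ∃ x ∈ T, ¬ CurveSmoothPt T x ∧ p ∈ lineOf x := by
  induction p using Projectivization.ind with | h y hy => ?_
  have k₁ : Projectivization.mk K y hy ∈ lineOfRep ![0, 0, 0, 0, 0, 1] ↔ y 0 = 0 ∧ y 1 = 0 := by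
    rw [mk_mem_lineOfRep]
    exact ⟨fun e => ⟨by simpa [wedgePt] using congrFun e 2, by simpa [wedgePt] using congrFun e 3⟩,
      fun e => by ext i; fin_cases i <;> simp [wedgePt, e]⟩
  have k₂ : Projectivization.mk K y hy ∈ lineOfRep ![1, 0, 0, 0, 0, 0] ↔ y 2 = 0 ∧ y 3 = 0 := by
    rw [mk_mem_lineOfRep]
    exact ⟨fun e => ⟨by simpa [wedgePt] using congrFun e 0, by simpa [wedgePt] using congrFun e 1⟩,
      fun e => by ext i; fin_cases i <;> simp [wedgePt, e]⟩
  rw [h.mem_singLocus_iff, k₁, k₂]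
  constructor
  · rintro ⟨hF, hg⟩
    by_cases hu : y 0 = 0 ∧ y 1 = 0
    · exact Or.inl ⟨(h.grad_eq_zero_fst_iff hy hu.1 hu.2).1 hg, hu⟩
    by_cases hv : y 2 = 0 ∧ y 3 = 0
    · exact Or.inr (Or.inl ⟨(h.grad_eq_zero_snd_iff hy hv.1 hv.2).1 hg, hv⟩)
    have hs : segre y ≠ 0 := segre_ne_zero_iff.2 ⟨hu, hv⟩
    refine Or.inr (Or.inr ⟨_, (h.mk_mem_curve _ hs).2 ⟨y, rfl, hF⟩, ?_, ?_⟩)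
    · rwa [h.curveSmoothPt_iff hs hF, not_not]
    · rw [mk_mem_lineOf, wedgePt_segre_eq_zero_iff hs]
      exact ⟨1, 1, by ext i; fin_cases i <;> simp⟩
  · rintro (⟨ha, hu⟩ | ⟨ha, hv⟩ | ⟨x, hxX, hx, hyx⟩)
    · exact ⟨h.eval_eq_zero_fst hu.1 hu.2, (h.grad_eq_zero_fst_iff hy hu.1 hu.2).2 ha⟩
    · exact ⟨h.eval_eq_zero_snd hv.1 hv.2, (h.grad_eq_zero_snd_iff hy hv.1 hv.2).2 ha⟩
    · induction x using Projectivization.ind with | h z hz => ?_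
      obtain ⟨t, rfl, ht⟩ := (h.mk_mem_curve z hz).1 hxX
      rw [h.curveSmoothPt_iff hz ht, not_not] at hx
      rw [mk_mem_lineOf, wedgePt_segre_eq_zero_iff hz] at hyx
      obtain ⟨b, c, rfl⟩ := hyx
      exact ⟨by rw [eval_scale h.fst h.snd, ht, mul_zero, mul_zero], h.grad_scale hx b c⟩

/-- Both standard lines meet every line of the curve. -/
lemma inter_lineOf_nonempty (h : IsBihomSurface S T F a₁ a₂ d) {x : PP K 6} (hx : x ∈ T) :
    (lineOfRep ![0, 0, 0, 0, 0, 1] ∩ lineOf x).Nonempty ∧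
      (lineOfRep ![1, 0, 0, 0, 0, 0] ∩ lineOf x).Nonempty := by
  induction x using Projectivization.ind with | h z hz => ?_
  obtain ⟨y, rfl, -⟩ := (h.mk_mem_curve z hz).1 hx
  obtain ⟨hu, hv⟩ := segre_ne_zero_iff.1 hz
  constructor
  · refine ⟨Projectivization.mk K ![0, 0, y 2, y 3]
      (fun e => hv ⟨congrFun e 2, congrFun e 3⟩), ?_, ?_⟩
    · rw [mk_mem_lineOfRep]
      ext i; fin_cases i <;> simp [wedgePt]
    · rw [mk_mem_lineOf, wedgePt_segre_eq_zero_iff hz]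
      exact ⟨0, 1, by simp⟩
  · refine ⟨Projectivization.mk K ![y 0, y 1, 0, 0]
      (fun e => hu ⟨congrFun e 0, congrFun e 1⟩), ?_, ?_⟩
    · rw [mk_mem_lineOfRep]
      ext i; fin_cases i <;> simp [wedgePt]
    · rw [mk_mem_lineOf, wedgePt_segre_eq_zero_iff hz]
      exact ⟨1, 0, by simp⟩

end IsBihomSurface

/-! ### Reduction to standard coordinates -/

lemma exists_isBihomSurface [Infinite K] {S : Set (PP K 4)} {T : Set (PP K 6)}
    {F : MvPolynomial (Fin 4) K} {d : ℕ} (hF : Prime F) (hhom : F.IsHomogeneous d) (hd : 3 ≤ d)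
    (hvan : ∀ p, p ∈ vanIdeal S ↔ F ∣ p)
    (hmem : ∀ (v : Fin 4 → K) (hv : v ≠ 0), Projectivization.mk K v hv ∈ S ↔ eval v F = 0)
    (hne : T.Nonempty) (hT : T ⊆ linesOf S) (hST : ∀ p ∈ S, ∃ x ∈ T, p ∈ lineOf x)
    (hstd : ∀ (z : Fin 6 → K) (hz : z ≠ 0), Projectivization.mk K z hz ∈ T → z 0 = 0 ∧ z 5 = 0) :
    ∃ a₁ a₂, IsBihomSurface S T F a₁ a₂ d := by
  have hseg : ∀ (z : Fin 6 → K) (hz : z ≠ 0), Projectivization.mk K z hz ∈ T →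
      ∃ y, z = segre y := by
    intro z hz hzT
    obtain ⟨h0, h5⟩ := hstd z hz hzT
    exact exists_segre_eq h0 h5 ((mk_mem_grass hz).1 (hT hzT).1)
  have hline : ∀ (v : Fin 4 → K) (hv : v ≠ 0), Projectivization.mk K v hv ∈ S →
      ∃ (y : Fin 4 → K) (hy : segre y ≠ 0) (b c : K), Projectivization.mk K (segre y) hy ∈ T ∧
        v = ![b * y 0, b * y 1, c * y 2, c * y 3] := by
    intro v hv hvS
    obtain ⟨x, hxT, hx⟩ := hST _ hvS
    induction x using Projectivization.ind with | h z hz => ?_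
    obtain ⟨y, rfl⟩ := hseg z hz hxT
    rw [mk_mem_lineOf, wedgePt_segre_eq_zero_iff hz] at hx
    obtain ⟨b, c, e⟩ := hx
    exact ⟨y, hz, b, c, hxT, e⟩
  have hscale : ∀ (y : Fin 4 → K) (hy : segre y ≠ 0) (b c : K),
      Projectivization.mk K (segre y) hy ∈ T → ∀ (u : Fin 4 → K) (hu : u ≠ 0),
      u = ![b * y 0, b * y 1, c * y 2, c * y 3] → Projectivization.mk K u hu ∈ S := by
    intro y hy b c hyT u hu e
    apply (hT hyT).2
    rw [mk_mem_lineOf, wedgePt_segre_eq_zero_iff hy]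
    exact ⟨b, c, e⟩
  obtain ⟨a₁, ha₁⟩ := exists_isWeightedHomogeneous hF.ne_zero hvan ![1, 1, 0, 0] (by
    intro r v u hv hu _ e hvS
    obtain ⟨y, hy, b, c, hyT, rfl⟩ := hline v hv hvS
    refine hscale y hy (r * b) c hyT u hu ?_
    rw [e]
    ext i; fin_cases i <;> simp [mul_assoc])
  obtain ⟨a₂, ha₂⟩ := exists_isWeightedHomogeneous hF.ne_zero hvan ![0, 0, 1, 1] (by
    intro r v u hv hu _ e hvS
    obtain ⟨y, hy, b, c, hyT, rfl⟩ := hline v hv hvS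
    refine hscale y hy b (r * c) hyT u hu ?_
    rw [e]
    ext i; fin_cases i <;> simp [mul_assoc])
  refine ⟨a₁, a₂, hF, hhom, hd, ha₁, ha₂, hvan, hmem, fun z hz => ⟨fun hzT => ?_, ?_⟩, hne⟩
  · obtain ⟨y, rfl⟩ := hseg z hz hzT
    refine ⟨y, rfl, ?_⟩
    rw [← hmem y (ne_zero_of_segre_ne_zero hz)]
    exact hscale y hz 1 1 hzT _ _ (by ext i; fin_cases i <;> simp)
  · rintro ⟨y, rfl, hy⟩
    rw [← hmem y (ne_zero_of_segre_ne_zero hz)] at hy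
    obtain ⟨x, hx, b, c, hxT, rfl⟩ := hline y _ hy
    have e := segre_scale b c x
    have : Projectivization.mk K _ hz = Projectivization.mk K (segre x) hx :=
      (Projectivization.mk_eq_mk_iff' K _ _ _ _).2 ⟨b * c, e.symm⟩
    rwa [this]

lemma mk_mem_image_iff {n : ℕ} (A : (Fin n → K) ≃ₗ[K] (Fin n → K)) (S : Set (PP K n))
    {v : Fin n → K} (hv : v ≠ 0) :
    Projectivization.mk K v hv ∈ projMap A '' S ↔
      Projectivization.mk K (A.symm v) (A.symm.map_ne_zero_iff.2 hv) ∈ S := by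
  have e : projMap A (Projectivization.mk K (A.symm v) (A.symm.map_ne_zero_iff.2 hv)) =
      Projectivization.mk K v hv := by rw [projMap_mk]; simp
  rw [← e, projMap_mem_image]

lemma mem_vanIdeal_image_iff [Infinite K] {n : ℕ} (A : (Fin n → K) ≃ₗ[K] (Fin n → K))
    {S : Set (PP K n)} {F : MvPolynomial (Fin n) K} (hF : ∀ p, p ∈ vanIdeal S ↔ F ∣ p)
    (p : MvPolynomial (Fin n) K) :
    p ∈ vanIdeal (projMap A '' S) ↔ linSubstEquiv A.symm F ∣ p := by
  have e : linSubstEquiv A.symm (linSubstEquiv A p) = p :=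
    MvPolynomial.funext fun v => by simp [eval_linSubstEquiv]
  rw [← e, map_dvd_iff, ← hF, e, mem_vanIdeal, mem_vanIdeal]
  constructor
  · intro h v hv hS
    rw [eval_linSubstEquiv]
    refine h (A v) (A.map_ne_zero_iff.2 hv) ?_
    rwa [← projMap_mk A hv, projMap_mem_image]
  · intro h v hv hS
    rw [mk_mem_image_iff] at hS
    have := h _ _ hS
    rwa [eval_linSubstEquiv, LinearEquiv.apply_symm_apply] at this

lemma vanIdeal_ne_bot {S : Set (PP K 4)} (hS : ZClosed S) {d : ℕ} (hdeg : HasSurfDeg S d) :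
    vanIdeal S ≠ ⊥ := by
  intro hbot
  obtain ⟨w, -, hw, -⟩ := hdeg.2
  refine hw fun p _ => ?_
  induction p using Projectivization.ind with | h v hv => ?_
  refine mk_mem_of_vanIdeal hS hv fun p hp => ?_
  rw [hbot, Ideal.mem_bot] at hp
  rw [hp, map_zero]

/-! STATEMENT 10: a ruled surface whose curve `C` spans a 3-space `P(C)` which is the
intersection of exactly two tangent spaces of the Grassmannian. -/

theorem statement_10 (K : Type) [Field K] [IsAlgClosed K]
    (S : Set (PP K 4)) (d : ℕ) (hd : 3 ≤ d)
    (hruled : IsRuled S) (hdeg : HasSurfDeg S d) (hcone : ¬ IsCone S)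
    -- `C` is the irreducible degree-`d` curve component of the set of lines on `S`,
    -- and `S` is the union of the lines of `C`:
    (C : Set (PP K 6)) (hCsub : C ⊆ linesOf S)
    (hCcl : ZClosed C) (hCirr : ZIrred C) (hCdim : HasDim C 1) (hCdeg : HasCurveDeg C d)
    (hfin : (linesOf S \ C).Finite)
    (hSC : S = {p | ∃ x ∈ C, p ∈ lineOf x})
    -- `dim P(C) = 3`:
    (hspan : Module.finrank K (spanOfSet C) = 4)
    -- `P(C)` is the intersection of the tangent spaces of `Gr` at `w̄₁ ≠ w̄₂`:
    (x₁ x₂ : PP K 6) (hx₁ : x₁ ∈ grass K) (hx₂ : x₂ ∈ grass K) (hne : x₁ ≠ x₂)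
    (hPC : projSpanOf C = tangentGr x₁ ∩ tangentGr x₂) :
    -- the lines `w̄₁` and `w̄₂` do not intersect:
    lineOf x₁ ∩ lineOf x₂ = ∅ ∧
    -- in suitable coordinates the equation of `S` is bihomogeneous of bidegree
    -- `(a₁,a₂)` with `a₁ + a₂ = d` in the pairs `(t₁,t₂)` and `(t₃,t₄)`, where `w̄₁`
    -- becomes the line `t₁ = t₂ = 0` and `w̄₂` the line `t₃ = t₄ = 0`:
    ∃ (A : (Fin 4 → K) ≃ₗ[K] (Fin 4 → K)) (F : MvPolynomial (Fin 4) K) (a₁ a₂ : ℕ),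
      IsWeightedHomogeneous ![1, 1, 0, 0] F a₁ ∧
      IsWeightedHomogeneous ![0, 0, 1, 1] F a₂ ∧
      a₁ + a₂ = d ∧ F ≠ 0 ∧
      projMap A '' S = zeroLocus {F} ∧
      projMap A '' lineOf x₁ = lineOfRep ![0, 0, 0, 0, 0, 1] ∧
      projMap A '' lineOf x₂ = lineOfRep ![1, 0, 0, 0, 0, 0] ∧
      -- the singular locus of `S` consists of the lines `w̄ᵢ` with `aᵢ > 1` together
      -- with the lines corresponding to the singular points of `C`:
      singLocus S =
        {p | 1 < a₁ ∧ p ∈ lineOf x₁} ∪ {p | 1 < a₂ ∧ p ∈ lineOf x₂} ∪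
        {p | ∃ x ∈ C, ¬ CurveSmoothPt C x ∧ p ∈ lineOf x} ∧
    -- the isolated lines of `S` are exactly `w̄₁` and `w̄₂`:
    linesOf S \ C = {x₁, x₂} ∧
    -- `w̄₁` and `w̄₂` are directrices: they meet every line of `C`:
    (∀ x ∈ C, (lineOf x₁ ∩ lineOf x).Nonempty ∧ (lineOf x₂ ∩ lineOf x).Nonempty) := by
  have hinf : Infinite K := IsAlgClosed.instInfinite
  induction x₁ using Projectivization.ind with | h w₁ h₁ => ?_
  induction x₂ using Projectivization.ind with | h w₂ h₂ => ?_
  have q₁ := (mk_mem_grass h₁).1 hx₁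
  have q₂ := (mk_mem_grass h₂).1 hx₂
  have hpair : ∀ (z : Fin 6 → K) (hz : z ≠ 0), Projectivization.mk K z hz ∈ C →
      plPair w₁ z = 0 ∧ plPair w₂ z = 0 := by
    intro z hz hzC
    have hmem : Projectivization.mk K z hz ∈ projSpanOf C :=
      (mk_mem_projSub hz).2 (Submodule.subset_span ⟨hz, hzC⟩)
    rw [hPC] at hmem
    exact ⟨(mk_mem_tangentGr h₁ hz).1 hmem.1, (mk_mem_tangentGr h₂ hz).1 hmem.2⟩
  have hdis := lineOf_inter_lineOf_eq_empty hCirr (fun x hx => (hCsub hx).1) hspan h₁ h₂ q₁ q₂ hne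
    hpair
  refine ⟨hdis, ?_⟩
  obtain ⟨A, e₁, e₂⟩ := exists_linearEquiv_of_disjoint h₁ h₂ q₁ q₂ hdis
  obtain ⟨hScl, hSirr, hSdim, -⟩ := hruled
  obtain ⟨F, hF, hFvan⟩ := exists_prime_vanIdeal hSirr hSdim.1 (vanIdeal_ne_bot hScl hdeg)
  obtain ⟨e, hFhom⟩ := exists_isHomogeneous_of_vanIdeal hF.ne_zero hFvan
  have hFmem : ∀ (v : Fin 4 → K) (hv : v ≠ 0), Projectivization.mk K v hv ∈ S ↔ eval v F = 0 :=
    fun v hv => mk_mem_iff_of_vanIdeal hScl hFvan hv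
  obtain rfl := degree_eq_of_hasSurfDeg (by omega) hF hFhom hFmem hdeg
  let B := ext2Equiv A
  obtain ⟨a₁, a₂, h⟩ := exists_isBihomSurface (S := projMap A '' S) (T := projMap B '' C)
    (F := linSubstEquiv A.symm F) ((MulEquiv.prime_iff (linSubstEquiv A.symm)).2 hF)
    (isHomogeneous_linSubst _ hFhom) hd (mem_vanIdeal_image_iff A hFvan)
    (fun v hv => by rw [mk_mem_image_iff, hFmem, eval_linSubstEquiv]) (hCirr.1.image _)
    (by
      rintro _ ⟨x, hx, rfl⟩
      exact (projMap_ext2_mem_linesOf_image A S x).2 (hCsub hx))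
    (by
      rintro _ ⟨p, hp, rfl⟩
      rw [hSC] at hp
      obtain ⟨x, hx, hpx⟩ := hp
      exact ⟨_, Set.mem_image_of_mem _ hx,
        (projMap_mem_lineOf_ext2 A (hCsub hx).1 p).2 hpx⟩)
    (by
      intro z hz hzC
      rw [mk_mem_image_iff] at hzC
      have hzq := (mk_mem_grass _).1 (hCsub hzC).1
      obtain ⟨p₁, p₂⟩ := hpair _ _ hzC
      rw [← plPair_ext2Equiv A q₁ hzq, e₁, LinearEquiv.apply_symm_apply] at p₁
      rw [← plPair_ext2Equiv A q₂ hzq, e₂, LinearEquiv.apply_symm_apply] at p₂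
      exact ⟨by simpa [plPair] using p₁, by simpa [plPair] using p₂⟩)
  have l₁ : projMap A '' lineOf (Projectivization.mk K w₁ h₁) = lineOfRep ![0, 0, 0, 0, 0, 1] := by
    rw [image_lineOf A hx₁, projMap_mk, lineOf_mk, e₁]
  have l₂ : projMap A '' lineOf (Projectivization.mk K w₂ h₂) = lineOfRep ![1, 0, 0, 0, 0, 0] := by
    rw [image_lineOf A hx₂, projMap_mk, lineOf_mk, e₂]
  refine ⟨A, linSubstEquiv A.symm F, a₁, a₂, h.fst, h.snd, h.add_eq, h.prime.ne_zero, ?_, l₁, l₂,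
    ?_, ?_, ?_⟩
  · ext p
    induction p using Projectivization.ind with | h v hv => ?_
    rw [h.mk_mem, zeroLocus, Set.mem_ofPred_eq]
    simp only [Set.mem_singleton_iff, forall_eq]
    rw [vanishes_mk h.homogeneous]
  · ext p
    rw [← projMap_mem_singLocus_image A, h.mem_singLocus_iff_or, ← l₁, ← l₂, projMap_mem_image,
      projMap_mem_image, Set.union_assoc]
    simp only [Set.mem_union, Set.mem_ofPred_eq, Set.exists_mem_image, B, curveSmoothPt_image]
    refine or_congr_right (or_congr_right (exists_congr fun x => and_congr_right fun hx => ?_))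
    rw [projMap_mem_lineOf_ext2 A (hCsub hx).1]
  · ext x
    induction x using Projectivization.ind with | h z hz => ?_
    have := h.linesOf_diff (B.map_ne_zero_iff.2 hz)
    rw [← projMap_mk B hz, Set.mem_sdiff, projMap_mem_image, projMap_ext2_mem_linesOf_image,
      ← e₁, ← e₂] at this
    rw [Set.mem_sdiff, this, Set.mem_insert_iff, Set.mem_singleton_iff,
      Projectivization.mk_eq_mk_iff', Projectivization.mk_eq_mk_iff']
    simp only [← map_smul, B, EmbeddingLike.apply_eq_iff_eq, eq_comm]
  · intro x hx
    obtain ⟨n₁, n₂⟩ := h.inter_lineOf_nonempty (Set.mem_image_of_mem (projMap B) hx)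
    rw [← image_lineOf A (hCsub hx).1, ← l₁, ← Set.image_inter (projMap_injective A),
      Set.image_nonempty] at n₁
    rw [← image_lineOf A (hCsub hx).1, ← l₂, ← Set.image_inter (projMap_injective A),
      Set.image_nonempty] at n₂
    exact ⟨n₁, n₂⟩

end RQS
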